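/- (De Giorgi-type iteration) Under the structure setting and the weak solution setting, let θ > 0 be given and define T_{k,ρ} = θ·k²·G(k/ρ)^{−1} and Q_{k,ρ} = K_ρ × [−T_{k,ρ}, 0]. Then there exists ν0 ∈ (0,1), depending only on the data and θ, with the following property: for all k > 0 and ρ > 0 and every nonnegative bounded weak solution (u,V) on (the interior of) Q_{k,2ρ}, if meas{(x,t) ∈ Q_{k,2ρ} : u(x,t) < k} < ν0·meas(Q_{k,2ρ}), then ess inf over Q_{k,ρ} of u is at least k/2. -/

import Mathlib

open Real Set MeasureTheory

noncomputable section

/-- The open cube in `ℝ^N` of center `y` and half side-length `ρ`. -/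
def cube (N : ℕ) (y : EuclideanSpace ℝ (Fin N)) (ρ : ℝ) : Set (EuclideanSpace ℝ (Fin N)) :=
  {x | ∀ i, |x i - y i| < ρ}

/-- The parabolic boundary `(∂K × [T0,T1]) ∪ (K̄ × {T0})` of the cylinder `K × (T0,T1)`. -/
def parabolicBoundary (N : ℕ) (K : Set (EuclideanSpace ℝ (Fin N))) (T0 T1 : ℝ) :
    Set (EuclideanSpace ℝ (Fin N) × ℝ) :=
  (frontier K) ×ˢ (Icc T0 T1) ∪ (closure K) ×ˢ ({T0} : Set ℝ)

/-- `φ` vanishes in a neighborhood of the parabolic boundary of `K × (T0,T1)`. -/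
def VanishesNearParabolicBoundary (N : ℕ) (K : Set (EuclideanSpace ℝ (Fin N))) (T0 T1 : ℝ)
    (φ : EuclideanSpace ℝ (Fin N) → ℝ → ℝ) : Prop :=
  ∃ U : Set (EuclideanSpace ℝ (Fin N) × ℝ), IsOpen U ∧ parabolicBoundary N K T0 T1 ⊆ U ∧
    ∀ p ∈ U, φ p.1 p.2 = 0

/-- A bounded weak solution `(u, V)` of `u_t - div A(x,t,u,Du) = 0` on the cylinder
`Q = K × (T0,T1)` under the structure conditions `A·Du ≥ C0·G(|Du|)`,
`|A| ≤ C1·g(|Du|)`; `V` is the weak spatial gradient of `u`. -/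
structure IsBoundedWeakSolution (N : ℕ) (C0 C1 : ℝ) (g G : ℝ → ℝ)
    (K : Set (EuclideanSpace ℝ (Fin N))) (T0 T1 : ℝ)
    (u : EuclideanSpace ℝ (Fin N) → ℝ → ℝ)
    (V : EuclideanSpace ℝ (Fin N) → ℝ → EuclideanSpace ℝ (Fin N)) : Prop where
  bounded : ∃ M : ℝ, ∀ x ∈ K, ∀ t ∈ Ioo T0 T1, |u x t| ≤ M
  continuousOn : ContinuousOn (fun p : EuclideanSpace ℝ (Fin N) × ℝ => u p.1 p.2)
      (K ×ˢ Ioo T0 T1)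
  grad_measurable : Measurable (fun p : EuclideanSpace ℝ (Fin N) × ℝ => V p.1 p.2)
  grad_G_integrable : IntegrableOn (fun p : EuclideanSpace ℝ (Fin N) × ℝ => G ‖V p.1 p.2‖)
      (K ×ˢ Ioo T0 T1)
  weak_gradient : ∀ φ : EuclideanSpace ℝ (Fin N) × ℝ → ℝ, ContDiff ℝ (⊤ : ℕ∞) φ →
      HasCompactSupport φ → tsupport φ ⊆ K ×ˢ Ioo T0 T1 → ∀ i : Fin N,
      (∫ p in K ×ˢ Ioo T0 T1, u p.1 p.2 * fderiv ℝ φ p (EuclideanSpace.single i 1, 0)) =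
        - ∫ p in K ×ˢ Ioo T0 T1, V p.1 p.2 i * φ p
  weak_form : ∃ a : EuclideanSpace ℝ (Fin N) → ℝ → EuclideanSpace ℝ (Fin N),
      Measurable (fun p : EuclideanSpace ℝ (Fin N) × ℝ => a p.1 p.2) ∧
      (∀ᵐ p : EuclideanSpace ℝ (Fin N) × ℝ, p ∈ K ×ˢ Ioo T0 T1 →
        C0 * G ‖V p.1 p.2‖ ≤ ∑ i, a p.1 p.2 i * V p.1 p.2 i ∧
        ‖a p.1 p.2‖ ≤ C1 * g ‖V p.1 p.2‖) ∧
      ∀ φ : EuclideanSpace ℝ (Fin N) → ℝ → ℝ,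
        (∃ L, LipschitzWith L (fun p : EuclideanSpace ℝ (Fin N) × ℝ => φ p.1 p.2)) →
        VanishesNearParabolicBoundary N K T0 T1 φ →
        ∀ τ1 τ2 : ℝ, T0 ≤ τ1 → τ1 ≤ τ2 → τ2 ≤ T1 →
        ((∫ x in K, u x τ2 * φ x τ2) - ∫ x in K, u x τ1 * φ x τ1) =
          ∫ t in τ1..τ2, ∫ x in K,
            (u x t * deriv (φ x) t -
              ∑ i, a x t i * fderiv ℝ (fun y => φ y t) x (EuclideanSpace.single i 1))


section Moll
open Filter Topology Metric
open scoped Convolution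
variable {X : Type*} [NormedAddCommGroup X] [NormedSpace ℝ X] [FiniteDimensional ℝ X]
  [MeasurableSpace X] [BorelSpace X] (μ : Measure X) [μ.IsAddHaarMeasure]

/-- The mollifying bumps. -/
def bmp (X : Type*) [NormedAddCommGroup X] (n : ℕ) : ContDiffBump (0 : X) where
  rIn := 1 / ((n : ℝ) + 1)
  rOut := 2 / ((n : ℝ) + 1)
  rIn_pos := by positivity
  rIn_lt_rOut := by
    have : (0:ℝ) < (n:ℝ) + 1 := by positivity
    gcongr; norm_num

lemma bmp_rOut_tendsto : Tendsto (fun n => (bmp X n).rOut) atTop (𝓝 0) := by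
  have := (tendsto_one_div_add_atTop_nhds_zero_nat (𝕜 := ℝ)).const_mul 2
  simp only [mul_zero] at this
  refine this.congr fun n => ?_
  simp only [bmp]; ring

/-- Mollification. -/
def moll (n : ℕ) (f : X → ℝ) : X → ℝ :=
  (bmp X n).normed μ ⋆[ContinuousLinearMap.lsmul ℝ ℝ, μ] f

lemma moll_apply (n : ℕ) (f : X → ℝ) (p : X) :
    moll μ n f p = ∫ q, (bmp X n).normed μ q * f (p - q) ∂μ := rfl

lemma moll_apply' (n : ℕ) (f : X → ℝ) (p : X) :
    moll μ n f p = ∫ q, (bmp X n).normed μ (p - q) * f q ∂μ :=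
  convolution_eq_swap _

lemma moll_tendsto {f : X → ℝ} (hf : Integrable f μ) :
    ∀ᵐ p ∂μ, Tendsto (fun n => moll μ n f p) atTop (𝓝 (f p)) := by
  refine ContDiffBump.ae_convolution_tendsto_right_of_locallyIntegrable (K := 2)
    bmp_rOut_tendsto (Eventually.of_forall fun n => ?_) hf.locallyIntegrable
  simp only [bmp]; apply le_of_eq; ring

lemma moll_integrable (n : ℕ) {f : X → ℝ} (hf : Integrable f μ) : Integrable (moll μ n f) μ :=
  (bmp X n).integrable_normed.integrable_convolution _ hf

lemma moll_integral (n : ℕ) {f : X → ℝ} (hf : Integrable f μ) :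
    ∫ p, moll μ n f p ∂μ = ∫ p, f p ∂μ := by
  have := integral_convolution (ContinuousLinearMap.lsmul ℝ ℝ) (μ := μ) (ν := μ)
    ((bmp X n).integrable_normed (μ := μ)) hf
  rw [moll, this, ContDiffBump.integral_normed]; simp

lemma moll_contDiff (n : ℕ) {f : X → ℝ} (hf : Integrable f μ) : ContDiff ℝ 1 (moll μ n f) :=
  HasCompactSupport.contDiff_convolution_left (n := 1) _ (bmp X n).hasCompactSupport_normed
    ((bmp X n).contDiff_normed) hf.locallyIntegrable

lemma moll_exists (n : ℕ) {f : X → ℝ} (hf : Integrable f μ) (p : X) :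
    Integrable (fun q => (bmp X n).normed μ q * f (p - q)) μ :=
  HasCompactSupport.convolutionExists_left (ContinuousLinearMap.lsmul ℝ ℝ) 
    (bmp X n).hasCompactSupport_normed
    ((bmp X n).continuous_normed) hf.locallyIntegrable p

lemma moll_bound (n : ℕ) {f : X → ℝ} {M : ℝ} (hM : ∀ p, |f p| ≤ M) (p : X) :
    |moll μ n f p| ≤ M := by
  rw [moll_apply]
  have h1 : ∀ q, ‖(bmp X n).normed μ q * f (p - q)‖ ≤ (bmp X n).normed μ q * M := by
    intro q
    rw [norm_mul, norm_of_nonneg ((bmp X n).nonneg_normed q)]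
    exact mul_le_mul_of_nonneg_left (hM _) ((bmp X n).nonneg_normed q)
  have := norm_integral_le_of_norm_le (((bmp X n).integrable_normed (μ := μ)).mul_const M)
    (Eventually.of_forall h1)
  rwa [integral_mul_const, ContDiffBump.integral_normed, one_mul] at this

lemma moll_nonneg (n : ℕ) {f : X → ℝ} (hf : ∀ p, 0 ≤ f p) (p : X) : 0 ≤ moll μ n f p := by
  rw [moll_apply]
  exact integral_nonneg fun q => mul_nonneg ((bmp X n).nonneg_normed q) (hf _)

lemma moll_abs_le (n : ℕ) (f : X → ℝ) (p : X) :
    |moll μ n f p| ≤ moll μ n (fun q => |f q|) p := by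
  rw [moll_apply, moll_apply]
  refine (norm_integral_le_integral_norm (μ := μ)
    (fun q => (bmp X n).normed μ q * f (p - q))).trans (le_of_eq ?_)
  congr 1; ext q
  rw [norm_mul, norm_of_nonneg ((bmp X n).nonneg_normed q), Real.norm_eq_abs]

lemma moll_mul_le (n : ℕ) {f g H : X → ℝ} (hf : Integrable f μ) (hg : Integrable g μ)
    (hH : Integrable H μ)
    (h : ∀ᵐ p ∂μ, ∀ q, |f p| * |g q| ≤ H p + H q) (p : X) :
    |moll μ n f p * moll μ n g p| ≤ 2 * moll μ n H p := by
  set η := (bmp X n).normed μ with hη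
  have hη0 : ∀ q, 0 ≤ η q := (bmp X n).nonneg_normed
  have hη1 : ∫ q, η q ∂μ = 1 := (bmp X n).integral_normed
  have hηi : Integrable η μ := (bmp X n).integrable_normed
  have key : moll μ n (fun q => |f q|) p * moll μ n (fun q => |g q|) p ≤ 2 * moll μ n H p := by
    have e1 : moll μ n (fun q => |f q|) p * moll μ n (fun q => |g q|) p
        = ∫ s, η s * |f (p - s)| * moll μ n (fun q => |g q|) p ∂μ := by
      rw [integral_mul_const]; rfl
    have e2 : 2 * moll μ n H p = ∫ s, (η s * H (p - s) + η s * moll μ n H p) ∂μ := by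
      rw [integral_add (moll_exists μ n hH p) (hηi.mul_const _), integral_mul_const, hη1,
        ← moll_apply]; ring
    rw [e1, e2]
    apply integral_mono_ae
    · exact (moll_exists μ n hf.abs p).mul_const _
    · exact (moll_exists μ n hH p).add (hηi.mul_const _)
    · have hq : ∀ᵐ s ∂μ, ∀ q, |f (p - s)| * |g q| ≤ H (p - s) + H q :=
        (quasiMeasurePreserving_sub_left μ p).ae h
      filter_upwards [hq] with s hs
      rw [mul_assoc, ← mul_add]
      refine mul_le_mul_of_nonneg_left ?_ (hη0 s)
      have e3 : |f (p - s)| * moll μ n (fun q => |g q|) p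
          = ∫ r, η r * (|f (p - s)| * |g (p - r)|) ∂μ := by
        rw [moll_apply, ← integral_const_mul]; congr 1; ext r; simp only [hη]; ring
      have e4 : H (p - s) + moll μ n H p = ∫ r, (η r * H (p - s) + η r * H (p - r)) ∂μ := by
        rw [integral_add (hηi.mul_const _) (moll_exists μ n hH p), integral_mul_const, hη1,
          ← moll_apply]; ring
      rw [e3, e4]
      apply integral_mono
      · have := (moll_exists μ n hg.abs p).const_mul (|f (p - s)|)
        refine this.congr (Eventually.of_forall fun r => ?_)
        simp only [hη]; ring
      · exact (hηi.mul_const _).add (moll_exists μ n hH p)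
      · intro r
        simp only
        rw [← mul_add]
        exact mul_le_mul_of_nonneg_left (hs _) (hη0 r)
  rw [abs_mul]
  refine le_trans ?_ key
  exact mul_le_mul (moll_abs_le μ n f p) (moll_abs_le μ n g p) (abs_nonneg _)
    (moll_nonneg μ n (fun _ => abs_nonneg _) p)

lemma moll_fderiv (n : ℕ) {f : X → ℝ} (hf : Integrable f μ) (p v : X) :
    fderiv ℝ (moll μ n f) p v =
      - ∫ q, f q * fderiv ℝ (fun q => (bmp X n).normed μ (p - q)) q v ∂μ := by
  have hd := HasCompactSupport.hasFDerivAt_convolution_left (ContinuousLinearMap.lsmul ℝ ℝ)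
    (μ := μ) (bmp X n).hasCompactSupport_normed ((bmp X n).contDiff_normed (μ := μ) (n := 1))
    hf.locallyIntegrable p
  have hex := HasCompactSupport.convolutionExists_left
    ((ContinuousLinearMap.lsmul ℝ ℝ : ℝ →L[ℝ] ℝ →L[ℝ] ℝ).precompL X) (μ := μ)
    ((bmp X n).hasCompactSupport_normed (μ := μ).fderiv (𝕜 := ℝ))
    (((bmp X n).contDiff_normed (μ := μ) (n := 1)).continuous_fderiv one_ne_zero)
    hf.locallyIntegrable p
  have : fderiv ℝ (moll μ n f) p = _ := hd.fderiv
  rw [this, convolution_eq_swap, ContinuousLinearMap.integral_apply, ← integral_neg]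
  · congr 1; ext q
    have h1 : fderiv ℝ (fun q => (bmp X n).normed μ (p - q)) q
        = - fderiv ℝ ((bmp X n).normed μ) (p - q) := by
      have hdf : DifferentiableAt ℝ ((bmp X n).normed μ) (p - q) :=
        ((bmp X n).contDiff_normed (μ := μ) (n := 1)).differentiable one_ne_zero _
      have h3 : HasFDerivAt (fun q : X => p - q) (-(ContinuousLinearMap.id ℝ X)) q := by
        simpa using (hasFDerivAt_id (𝕜 := ℝ) q).const_sub p
      have := (hdf.hasFDerivAt.comp q h3).fderiv
      rw [Function.comp_def] at this
      rw [this]; ext; simp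
    rw [h1]
    simp [ContinuousLinearMap.precompL_apply, mul_comm]
  · exact hex.integrable_swap

lemma test_tsupport (n : ℕ) (p : X) :
    tsupport (fun q => (bmp X n).normed μ (p - q)) ⊆ closedBall p (bmp X n).rOut := by
  apply closure_minimal _ isClosed_closedBall
  intro q hq
  have : p - q ∈ Function.support ((bmp X n).normed μ) := hq
  rw [ContDiffBump.support_normed_eq, mem_ball_zero_iff] at this
  rw [mem_closedBall, dist_comm, dist_eq_norm]; exact this.le

lemma test_compact (n : ℕ) (p : X) :
    HasCompactSupport (fun q => (bmp X n).normed μ (p - q)) := 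
  (isCompact_closedBall p (bmp X n).rOut).of_isClosed_subset (isClosed_tsupport _)
    (test_tsupport μ n p)

lemma test_contDiff (n : ℕ) (p : X) :
    ContDiff ℝ (⊤ : ℕ∞) (fun q => (bmp X n).normed μ (p - q)) :=
  (bmp X n).contDiff_normed.comp (contDiff_const.sub contDiff_id)

/-- Dominated convergence with mollified dominating functions. -/
lemma gdct {H : X → ℝ} (hH : Integrable H μ) (hH0 : ∀ p, 0 ≤ H p) (F : ℕ → X → ℝ) (F' : X → ℝ)
    (hm : ∀ n, AEStronglyMeasurable (F n) μ)
    (hb : ∀ n p, |F n p| ≤ moll μ n H p)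
    (hl : ∀ᵐ p ∂μ, Tendsto (fun n => F n p) atTop (𝓝 (F' p))) :
    Tendsto (fun n => ∫ p, F n p ∂μ) atTop (𝓝 (∫ p, F' p ∂μ)) := by
  have hFi : ∀ n, Integrable (F n) μ := fun n =>
    (moll_integrable μ n hH).mono' (hm n) (Eventually.of_forall (hb n))
  -- truncations
  set T : ℕ → X → ℝ := fun n p => max (-(H p)) (min (F n p) (H p)) with hT
  have hTm : ∀ n, AEStronglyMeasurable (T n) μ := fun n =>
    hH.aestronglyMeasurable.neg.sup ((hm n).inf hH.aestronglyMeasurable)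
  have hTb : ∀ n p, |T n p| ≤ H p := fun n p => by
    rw [abs_le]
    exact ⟨le_max_left _ _, max_le (by linarith [hH0 p]) (min_le_right _ _)⟩
  have hmH := moll_tendsto μ hH
  have hF'b : ∀ᵐ p ∂μ, |F' p| ≤ H p := by
    filter_upwards [hl, hmH] with p h1 h2
    exact le_of_tendsto_of_tendsto' h1.abs h2 (fun n => hb n p)
  have t1 : Tendsto (fun n => ∫ p, T n p ∂μ) atTop (𝓝 (∫ p, F' p ∂μ)) := by
    refine tendsto_integral_of_dominated_convergence H hTm hH
      (fun n => Eventually.of_forall (hTb n)) ?_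
    filter_upwards [hl, hF'b] with p h1 h2
    have h3 : F' p = max (-(H p)) (min (F' p) (H p)) := by
      rw [abs_le] at h2
      rw [min_eq_left h2.2, max_eq_right h2.1]
    rw [h3]
    exact tendsto_const_nhds.max (h1.min tendsto_const_nhds)
  have t2 : Tendsto (fun n => ∫ p, max (H p - moll μ n H p) 0 ∂μ) atTop (𝓝 0) := by
    have h00 : (0:ℝ) = ∫ _ : X, (0:ℝ) ∂μ := by simp
    nth_rewrite 2 [h00]
    refine tendsto_integral_of_dominated_convergence H
      (fun n => ((hH.sub (moll_integrable μ n hH)).pos_part).aestronglyMeasurable) hH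
      (fun n => Eventually.of_forall fun p => ?_) ?_
    · rw [Real.norm_eq_abs, abs_of_nonneg (le_max_right _ _)]
      exact max_le (by linarith [moll_nonneg μ n hH0 p]) (hH0 p)
    · filter_upwards [hmH] with p hp
      have := (tendsto_const_nhds (x := H p)).sub hp
      simpa using this.max (tendsto_const_nhds (x := (0:ℝ)))
  have hd : ∀ n, |∫ p, F n p ∂μ - ∫ p, T n p ∂μ| ≤ ∫ p, max (H p - moll μ n H p) 0 ∂μ := by
    intro n
    have hTi : Integrable (T n) μ := hH.mono' (hTm n) (Eventually.of_forall (hTb n))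
    rw [← integral_sub (hFi n) hTi]
    have hi1 : Integrable (fun p => max (H p - moll μ n H p) 0) μ :=
      (hH.sub (moll_integrable μ n hH)).pos_part
    have hi2 : Integrable (fun p => moll μ n H p - H p) μ := (moll_integrable μ n hH).sub hH
    have e : ∫ p, max (H p - moll μ n H p) 0 ∂μ =
        ∫ p, (max (H p - moll μ n H p) 0 + (moll μ n H p - H p)) ∂μ := by
      rw [integral_add hi1 hi2,
        integral_sub (moll_integrable μ n hH) hH, moll_integral μ n hH]; ring
    rw [e]
    refine norm_integral_le_of_norm_le (f := fun a => F n a - T n a) (hi1.add hi2)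
      (Eventually.of_forall fun p => ?_)
    have h1 := hb n p
    have h0 := hH0 p
    have h4 := le_max_left (H p - moll μ n H p) 0
    have h5 := le_max_right (H p - moll μ n H p) 0
    simp only [hT, Real.norm_eq_abs]
    rw [abs_le] at h1
    rcases le_total (F n p) (H p) with h2 | h2
    · rw [min_eq_left h2]
      rcases le_total (-(H p)) (F n p) with h3 | h3
      · rw [max_eq_right h3, sub_self, abs_zero]; linarith
      · rw [max_eq_left h3, abs_of_nonpos (by linarith)]; linarith
    · rw [min_eq_right h2, max_eq_right (by linarith), abs_of_nonneg (by linarith)]; linarith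
  have t3 : Tendsto (fun n => ∫ p, F n p ∂μ - ∫ p, T n p ∂μ) atTop (𝓝 0) :=
    squeeze_zero_norm hd t2
  simpa using t3.add t1

end Moll

section Ident
open Filter Topology Metric
variable {X : Type*} [NormedAddCommGroup X] [NormedSpace ℝ X] [FiniteDimensional ℝ X]
  [MeasurableSpace X] [BorelSpace X] (μ : Measure X) [μ.IsAddHaarMeasure]

/-- Abstract data of a weak solution, extended by zero. -/
structure MData (N : ℕ) (e : Fin N → X) (et : X) (Q : Set X) (u : X → ℝ)
    (Vc ac : Fin N → X → ℝ) (H : X → ℝ) (M : ℝ) : Prop where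
  Qopen : IsOpen Q
  u_int : Integrable u μ
  u_bd : ∀ p, |u p| ≤ M
  V_int : ∀ i, Integrable (Vc i) μ
  a_int : ∀ i, Integrable (ac i) μ
  H_int : Integrable H μ
  H_nonneg : ∀ p, 0 ≤ H p
  dom : ∀ i, ∀ᵐ p ∂μ, ∀ q, |ac i p| * |Vc i q| ≤ H p + H q
  weakV : ∀ φ : X → ℝ, ContDiff ℝ (⊤ : ℕ∞) φ → HasCompactSupport φ → tsupport φ ⊆ Q → ∀ i,
    ∫ p, u p * fderiv ℝ φ p (e i) ∂μ = - ∫ p, Vc i p * φ p ∂μ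
  weakE : ∀ φ : X → ℝ, ContDiff ℝ (⊤ : ℕ∞) φ → HasCompactSupport φ → tsupport φ ⊆ Q →
    ∫ p, u p * fderiv ℝ φ p et ∂μ = ∑ i, ∫ p, ac i p * fderiv ℝ φ p (e i) ∂μ

lemma moll_const_mul (n : ℕ) (f : X → ℝ) (c : ℝ) (p : X) :
    moll μ n (fun q => c * f q) p = c * moll μ n f p := by
  rw [moll_apply, moll_apply, ← integral_const_mul]; congr 1; ext q; ring

lemma cont_bdd (f : ℝ → ℝ) (hf : Continuous f) (M : ℝ) :
    ∃ c, 0 ≤ c ∧ ∀ s, |s| ≤ M → |f s| ≤ c := by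
  obtain ⟨c, hc⟩ := (isCompact_Icc (a := -M) (b := M)).exists_bound_of_continuousOn hf.continuousOn
  exact ⟨max c 0, le_max_right _ _, fun s hs =>
    (hc s ⟨(abs_le.mp hs).1, (abs_le.mp hs).2⟩).trans (le_max_left _ _)⟩

lemma cs_bdd (f : X → ℝ) (hf : Continuous f) (hc : HasCompactSupport f) :
    ∃ c, 0 ≤ c ∧ ∀ p, |f p| ≤ c := by
  obtain ⟨c, hc⟩ := hc.exists_bound_of_continuous hf
  exact ⟨max c 0, le_max_right _ _, fun s => (hc s).trans (le_max_left _ _)⟩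

variable {N : ℕ} {e : Fin N → X} {et : X} {Q : Set X} {u : X → ℝ}
    {Vc ac : Fin N → X → ℝ} {H : X → ℝ} {M : ℝ}

variable {μ}

lemma MData.near (D : MData μ N e et Q u Vc ac H M) {ζ : X → ℝ} (hc : HasCompactSupport ζ)
    (hs : tsupport ζ ⊆ Q) : ∀ᶠ n in atTop, ∀ p ∈ tsupport ζ, closedBall p (bmp X n).rOut ⊆ Q := by
  obtain ⟨δ, hδ, h⟩ := hc.isCompact.exists_cthickening_subset_open D.Qopen hs
  have := bmp_rOut_tendsto (X := X)
  filter_upwards [this.eventually (gt_mem_nhds hδ)] with n hn p hp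
  exact (closedBall_subset_cthickening hp _).trans
    ((cthickening_mono hn.le _).trans h)

lemma MData.fderivV (D : MData μ N e et Q u Vc ac H M) {n : ℕ} {p : X}
    (h : closedBall p (bmp X n).rOut ⊆ Q) (i : Fin N) :
    fderiv ℝ (moll μ n u) p (e i) = moll μ n (Vc i) p := by
  rw [moll_fderiv μ n D.u_int, D.weakV _ (test_contDiff μ n p) (test_compact μ n p)
    ((test_tsupport μ n p).trans h), neg_neg, moll_apply']
  congr 1; ext q; ring

lemma MData.fderivE (D : MData μ N e et Q u Vc ac H M) {n : ℕ} {p : X}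
    (h : closedBall p (bmp X n).rOut ⊆ Q) :
    fderiv ℝ (moll μ n u) p et = ∑ i, fderiv ℝ (moll μ n (ac i)) p (e i) := by
  rw [moll_fderiv μ n D.u_int, D.weakE _ (test_contDiff μ n p) (test_compact μ n p)
    ((test_tsupport μ n p).trans h), ← Finset.sum_neg_distrib]
  exact Finset.sum_congr rfl fun i _ => (moll_fderiv μ n (D.a_int i) p (e i)).symm

lemma fderiv_comp_mul {f f' : ℝ → ℝ} (hf : ∀ s, HasDerivAt f (f' s) s) {U ζ : X → ℝ}
    (hU : ContDiff ℝ 1 U) (hζ : ContDiff ℝ 1 ζ) (p v : X) :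
    fderiv ℝ (fun p => f (U p) * ζ p) p v =
      f' (U p) * fderiv ℝ U p v * ζ p + f (U p) * fderiv ℝ ζ p v := by
  have h1 : HasFDerivAt (fun p => f (U p)) (f' (U p) • fderiv ℝ U p) p :=
    (hf (U p)).comp_hasFDerivAt p ((hU.differentiable one_ne_zero p).hasFDerivAt)
  have h2 := (h1.mul (hζ.differentiable one_ne_zero p).hasFDerivAt).fderiv
  rw [show (fun p => f (U p) * ζ p) = (fun p => f (U p)) * ζ from rfl, h2]
  simp; ring

lemma contDiff_of_deriv {f f' : ℝ → ℝ} (hf : ∀ s, HasDerivAt f (f' s) s) (hc : Continuous f') :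
    ContDiff ℝ 1 f := by
  rw [contDiff_one_iff_deriv]
  refine ⟨fun s => (hf s).differentiableAt, ?_⟩
  rwa [show deriv f = f' from funext fun s => (hf s).deriv]

lemma MData.ident_n (D : MData μ N e et Q u Vc ac H M) {F f f' : ℝ → ℝ}
    (hF : ∀ s, HasDerivAt F (f s) s) (hf : ∀ s, HasDerivAt f (f' s) s) (hf' : Continuous f')
    {ζ : X → ℝ} (hζ : ContDiff ℝ 1 ζ) (hc : HasCompactSupport ζ) {n : ℕ}
    (hn : ∀ p ∈ tsupport ζ, closedBall p (bmp X n).rOut ⊆ Q) :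
    ∑ i, ∫ p, moll μ n (ac i) p * moll μ n (Vc i) p * (f' (moll μ n u p) * ζ p) ∂μ =
      ∫ p, F (moll μ n u p) * fderiv ℝ ζ p et ∂μ -
      ∑ i, ∫ p, moll μ n (ac i) p * (f (moll μ n u p) * fderiv ℝ ζ p (e i)) ∂μ := by
  set U := moll μ n u with hUdef
  have hU : ContDiff ℝ 1 U := moll_contDiff μ n D.u_int
  have hA : ∀ i, ContDiff ℝ 1 (moll μ n (ac i)) := fun i => moll_contDiff μ n (D.a_int i)
  have hW : ∀ i, Continuous (moll μ n (Vc i)) := fun i => (moll_contDiff μ n (D.V_int i)).continuous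
  have hfC : ContDiff ℝ 1 f := contDiff_of_deriv hf hf'
  have hFC : ContDiff ℝ 1 F := contDiff_of_deriv hF hfC.continuous
  have hψ : ContDiff ℝ 1 (fun p => f (U p) * ζ p) := (hfC.comp hU).mul hζ
  have hψc : HasCompactSupport (fun p => f (U p) * ζ p) := hc.mul_left
  have hFU : ContDiff ℝ 1 (fun p => F (U p)) := hFC.comp hU
  have hdc : ∀ {g : X → ℝ}, ContDiff ℝ 1 g → ∀ v, Continuous (fun p => fderiv ℝ g p v) :=
    fun hg v => (hg.continuous_fderiv one_ne_zero).clm_apply continuous_const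
  -- time part
  have ht : ∫ p, F (U p) * fderiv ℝ ζ p et ∂μ = - ∫ p, fderiv ℝ U p et * (f (U p) * ζ p) ∂μ := by
    have hfd : ∀ p v, fderiv ℝ (fun p => F (U p)) p v = f (U p) * fderiv ℝ U p v := by
      intro p v
      have h1 : HasFDerivAt (fun p => F (U p)) (f (U p) • fderiv ℝ U p) p :=
        (hF (U p)).comp_hasFDerivAt p ((hU.differentiable one_ne_zero p).hasFDerivAt)
      rw [h1.fderiv]; simp
    rw [integral_mul_fderiv_eq_neg_fderiv_mul_of_integrable]
    · congr 2; ext p; rw [hfd]; ring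
    · exact ((hdc hFU et).mul hζ.continuous).integrable_of_hasCompactSupport hc.mul_left
    · exact (hFU.continuous.mul (hdc hζ et)).integrable_of_hasCompactSupport
        (hc.fderiv_apply (𝕜 := ℝ) et).mul_left
    · exact (hFU.continuous.mul hζ.continuous).integrable_of_hasCompactSupport hc.mul_left
    · exact fun p _ => hFU.differentiable one_ne_zero p
    · exact fun p _ => hζ.differentiable one_ne_zero p
  have hI1 : ∀ i, Integrable (fun p => fderiv ℝ (moll μ n (ac i)) p (e i) * (f (U p) * ζ p)) μ :=
    fun i => ((hdc (hA i) (e i)).mul hψ.continuous).integrable_of_hasCompactSupport hψc.mul_left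
  have ht2 : ∫ p, fderiv ℝ U p et * (f (U p) * ζ p) ∂μ
      = ∑ i, ∫ p, fderiv ℝ (moll μ n (ac i)) p (e i) * (f (U p) * ζ p) ∂μ := by
    rw [← integral_finsetSum _ (fun i _ => hI1 i)]
    congr 1; ext p
    by_cases hp : p ∈ tsupport ζ
    · rw [hUdef, D.fderivE (hn p hp), Finset.sum_mul]
    · simp [image_eq_zero_of_notMem_tsupport hp]
  have hs : ∀ i, - ∫ p, fderiv ℝ (moll μ n (ac i)) p (e i) * (f (U p) * ζ p) ∂μ =
      ∫ p, moll μ n (ac i) p * moll μ n (Vc i) p * (f' (U p) * ζ p) ∂μ +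
      ∫ p, moll μ n (ac i) p * (f (U p) * fderiv ℝ ζ p (e i)) ∂μ := by
    intro i
    rw [← integral_mul_fderiv_eq_neg_fderiv_mul_of_integrable (hI1 i)]
    · rw [← integral_add]
      · congr 1; ext p
        rw [fderiv_comp_mul hf hU hζ]
        by_cases hp : p ∈ tsupport ζ
        · rw [hUdef, D.fderivV (hn p hp) i]; ring
        · simp [image_eq_zero_of_notMem_tsupport hp]
      · exact ((((hA i).continuous.mul (hW i)).mul
          ((hf'.comp hU.continuous).mul hζ.continuous))).integrable_of_hasCompactSupport
          hc.mul_left.mul_left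
      · exact ((hA i).continuous.mul ((hfC.continuous.comp hU.continuous).mul
          (hdc hζ (e i)))).integrable_of_hasCompactSupport
          (hc.fderiv_apply (𝕜 := ℝ) (e i)).mul_left.mul_left
    · exact ((hA i).continuous.mul (hdc hψ (e i))).integrable_of_hasCompactSupport
        (hψc.fderiv_apply (𝕜 := ℝ) (e i)).mul_left
    · exact ((hA i).continuous.mul hψ.continuous).integrable_of_hasCompactSupport hψc.mul_left
    · exact fun p _ => (hA i).differentiable one_ne_zero p
    · exact fun p _ => hψ.differentiable one_ne_zero p
  rw [ht, ht2, ← Finset.sum_neg_distrib, Finset.sum_congr rfl (fun i _ => hs i),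
    Finset.sum_add_distrib]
  ring

/-- The fundamental identity. -/
lemma MData.ident (D : MData μ N e et Q u Vc ac H M) {F f f' : ℝ → ℝ}
    (hF : ∀ s, HasDerivAt F (f s) s) (hf : ∀ s, HasDerivAt f (f' s) s) (hf' : Continuous f')
    {ζ : X → ℝ} (hζ : ContDiff ℝ 1 ζ) (hc : HasCompactSupport ζ) (hs : tsupport ζ ⊆ Q) :
    ∑ i, ∫ p, ac i p * Vc i p * (f' (u p) * ζ p) ∂μ =
      ∫ p, F (u p) * fderiv ℝ ζ p et ∂μ -
      ∑ i, ∫ p, ac i p * (f (u p) * fderiv ℝ ζ p (e i)) ∂μ := by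
  have hfC : ContDiff ℝ 1 f := contDiff_of_deriv hf hf'
  have hFC : ContDiff ℝ 1 F := contDiff_of_deriv hF hfC.continuous
  have hdc : ∀ v, Continuous (fun p => fderiv ℝ ζ p v) :=
    fun v => (hζ.continuous_fderiv one_ne_zero).clm_apply continuous_const
  have hUc : ∀ n, Continuous (moll μ n u) := fun n => (moll_contDiff μ n D.u_int).continuous
  have hAc : ∀ i n, Continuous (moll μ n (ac i)) :=
    fun i n => (moll_contDiff μ n (D.a_int i)).continuous
  have hVc : ∀ i n, Continuous (moll μ n (Vc i)) :=
    fun i n => (moll_contDiff μ n (D.V_int i)).continuous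
  have hUb : ∀ n p, |moll μ n u p| ≤ M := fun n p => moll_bound μ n D.u_bd p
  have hUt := moll_tendsto μ D.u_int
  obtain ⟨cF, hcF0, hcF⟩ := cont_bdd F hFC.continuous M
  obtain ⟨cf, hcf0, hcf⟩ := cont_bdd f hfC.continuous M
  obtain ⟨cf', hcf'0, hcf'⟩ := cont_bdd f' hf' M
  obtain ⟨cz, hcz0, hcz⟩ := cs_bdd ζ hζ.continuous hc
  have L1 : ∀ i, Tendsto (fun n => ∫ p, moll μ n (ac i) p * moll μ n (Vc i) p *
      (f' (moll μ n u p) * ζ p) ∂μ) atTop (𝓝 (∫ p, ac i p * Vc i p * (f' (u p) * ζ p) ∂μ)) := by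
    intro i
    refine gdct μ (H := fun p => (2 * (cf' * cz)) * H p) (D.H_int.const_mul _)
      (fun p => mul_nonneg (by positivity) (D.H_nonneg p)) _ _ (fun n => ?_) (fun n p => ?_) ?_
    · exact (((hAc i n).mul (hVc i n)).mul
        ((hf'.comp (hUc n)).mul hζ.continuous)).aestronglyMeasurable
    · rw [abs_mul, moll_const_mul]
      have h1 := moll_mul_le μ n (D.a_int i) (D.V_int i) D.H_int (D.dom i) p
      have h2 : |f' (moll μ n u p) * ζ p| ≤ cf' * cz := by
        rw [abs_mul]; exact mul_le_mul (hcf' _ (hUb n p)) (hcz p) (abs_nonneg _) hcf'0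
      calc _ ≤ (2 * moll μ n H p) * (cf' * cz) := mul_le_mul h1 h2 (abs_nonneg _)
            (mul_nonneg zero_le_two (moll_nonneg μ n D.H_nonneg p))
        _ = _ := by ring
    · filter_upwards [hUt, moll_tendsto μ (D.a_int i), moll_tendsto μ (D.V_int i)] with p h1 h2 h3
      exact (h2.mul h3).mul (((hf'.tendsto _).comp h1).mul tendsto_const_nhds)
  have L2 : ∀ i, Tendsto (fun n => ∫ p, moll μ n (ac i) p *
      (f (moll μ n u p) * fderiv ℝ ζ p (e i)) ∂μ) atTop
      (𝓝 (∫ p, ac i p * (f (u p) * fderiv ℝ ζ p (e i)) ∂μ)) := by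
    intro i
    obtain ⟨cd, hcd0, hcd⟩ := cs_bdd _ (hdc (e i)) (hc.fderiv_apply (𝕜 := ℝ) (e i))
    refine gdct μ (H := fun p => (cf * cd) * |ac i p|) ((D.a_int i).abs.const_mul _)
      (fun p => mul_nonneg (by positivity) (abs_nonneg _)) _ _ (fun n => ?_) (fun n p => ?_) ?_
    · exact ((hAc i n).mul ((hfC.continuous.comp (hUc n)).mul (hdc (e i)))).aestronglyMeasurable
    · rw [abs_mul, moll_const_mul]
      have h2 : |f (moll μ n u p) * fderiv ℝ ζ p (e i)| ≤ cf * cd := by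
        rw [abs_mul]; exact mul_le_mul (hcf _ (hUb n p)) (hcd p) (abs_nonneg _) hcf0
      calc _ ≤ (moll μ n (fun q => |ac i q|) p) * (cf * cd) :=
            mul_le_mul (moll_abs_le μ n _ p) h2 (abs_nonneg _)
            (moll_nonneg μ n (fun _ => abs_nonneg _) p)
        _ = _ := by ring
    · filter_upwards [hUt, moll_tendsto μ (D.a_int i)] with p h1 h2
      exact h2.mul (((hfC.continuous.tendsto _).comp h1).mul tendsto_const_nhds)
  have L3 : Tendsto (fun n => ∫ p, F (moll μ n u p) * fderiv ℝ ζ p et ∂μ) atTop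
      (𝓝 (∫ p, F (u p) * fderiv ℝ ζ p et ∂μ)) := by
    refine tendsto_integral_of_dominated_convergence (fun p => cF * |fderiv ℝ ζ p et|)
      (fun n => ((hFC.continuous.comp (hUc n)).mul (hdc et)).aestronglyMeasurable)
      (((hdc et).integrable_of_hasCompactSupport (hc.fderiv_apply (𝕜 := ℝ) et)).abs.const_mul _)
      (fun n => Eventually.of_forall fun p => ?_) ?_
    · rw [norm_mul]; exact mul_le_mul_of_nonneg_right (hcF _ (hUb n p)) (abs_nonneg _)
    · filter_upwards [hUt] with p h1
      exact ((hFC.continuous.tendsto _).comp h1).mul tendsto_const_nhds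
  refine tendsto_nhds_unique (tendsto_finsetSum _ fun i _ => L1 i)
    ((L3.sub (tendsto_finsetSum _ fun i _ => L2 i)).congr' ?_)
  filter_upwards [D.near hc hs] with n hn
  exact (D.ident_n hF hf hf' hζ hc hn).symm

/-- Translation estimate for smooth functions. -/
lemma trans_smooth {w : X → ℝ} (hw : ContDiff ℝ 1 w) (hc : HasCompactSupport w) (y : X) :
    ∫ p, |w (p + y) - w p| ∂μ ≤ ∫ p, |fderiv ℝ w p y| ∂μ := by
  have hd : Continuous (fun p => fderiv ℝ w p y) :=
    (hw.continuous_fderiv one_ne_zero).clm_apply continuous_const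
  have hI2 : Integrable (fun p => fderiv ℝ w p y) μ :=
    hd.integrable_of_hasCompactSupport (hc.fderiv_apply (𝕜 := ℝ) y)
  have hwI : Integrable w μ := hw.continuous.integrable_of_hasCompactSupport hc
  have hI1 : Integrable (fun p => w (p + y) - w p) μ := (hwI.comp_add_right y).sub hwI
  have key : ∫⁻ p, ‖w (p + y) - w p‖ₑ ∂μ ≤ ∫⁻ p, ‖fderiv ℝ w p y‖ₑ ∂μ := by
    have h1 : ∀ p, ‖w (p + y) - w p‖ₑ ≤ ∫⁻ s in Ioc (0:ℝ) 1, ‖fderiv ℝ w (p + s • y) y‖ₑ := by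
      intro p
      have hder : ∀ s ∈ uIcc (0:ℝ) 1, HasDerivAt (fun s : ℝ => w (p + s • y))
          (fderiv ℝ w (p + s • y) y) s := by
        intro s _
        have h2 : HasDerivAt (fun s : ℝ => p + s • y) y s := by
          simpa using ((hasDerivAt_id s).smul_const y).const_add p
        exact (hw.differentiable one_ne_zero _).hasFDerivAt.comp_hasDerivAt s h2
      have hcont : Continuous (fun s : ℝ => fderiv ℝ w (p + s • y) y) :=
        hd.comp (by fun_prop)
      have := intervalIntegral.integral_eq_sub_of_hasDerivAt hder (hcont.intervalIntegrable _ _)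
      simp only [one_smul, zero_smul, add_zero] at this
      rw [← this, intervalIntegral.integral_of_le zero_le_one]
      exact enorm_integral_le_lintegral_enorm _
    calc _ ≤ ∫⁻ p, (∫⁻ s in Ioc (0:ℝ) 1, ‖fderiv ℝ w (p + s • y) y‖ₑ) ∂μ := lintegral_mono h1
      _ = ∫⁻ s in Ioc (0:ℝ) 1, (∫⁻ p, ‖fderiv ℝ w (p + s • y) y‖ₑ ∂μ) := by
        apply lintegral_lintegral_swap
        have : Continuous (fun z : X × ℝ => fderiv ℝ w (z.1 + z.2 • y) y) :=
          hd.comp (by fun_prop)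
        exact this.enorm.measurable.aemeasurable
      _ = ∫⁻ s in Ioc (0:ℝ) 1, (∫⁻ p, ‖fderiv ℝ w p y‖ₑ ∂μ) := by
        congr 1; ext s
        exact lintegral_add_right_eq_self (fun p => ‖fderiv ℝ w p y‖ₑ) (s • y)
      _ = _ := by simp
  rw [← ofReal_integral_norm_eq_lintegral_enorm hI1,
    ← ofReal_integral_norm_eq_lintegral_enorm hI2] at key
  exact (ENNReal.ofReal_le_ofReal_iff (integral_nonneg fun _ => norm_nonneg _)).mp key

/-- Translation estimate for the solution. -/
lemma MData.trans (D : MData μ N e et Q u Vc ac H M) {f f' : ℝ → ℝ}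
    (hf : ∀ s, HasDerivAt f (f' s) s) (hf' : Continuous f')
    {ζ : X → ℝ} (hζ : ContDiff ℝ 1 ζ) (hc : HasCompactSupport ζ) (hs : tsupport ζ ⊆ Q)
    (c : Fin N → ℝ) :
    ∫ p, |f (u (p + ∑ i, c i • e i)) * ζ (p + ∑ i, c i • e i) - f (u p) * ζ p| ∂μ ≤
      ∑ i, |c i| * (∫ p, |Vc i p * (f' (u p) * ζ p)| ∂μ +
        ∫ p, |f (u p) * fderiv ℝ ζ p (e i)| ∂μ) := by
  set y := ∑ i, c i • e i with hy
  have hfC : ContDiff ℝ 1 f := contDiff_of_deriv hf hf'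
  have hdc : ∀ v, Continuous (fun p => fderiv ℝ ζ p v) :=
    fun v => (hζ.continuous_fderiv one_ne_zero).clm_apply continuous_const
  have hUC : ∀ n, ContDiff ℝ 1 (moll μ n u) := fun n => (moll_contDiff μ n D.u_int)
  have hUc : ∀ n, Continuous (moll μ n u) := fun n => (hUC n).continuous
  have hVc : ∀ i n, Continuous (moll μ n (Vc i)) :=
    fun i n => (moll_contDiff μ n (D.V_int i)).continuous
  have hUb : ∀ n p, |moll μ n u p| ≤ M := fun n p => moll_bound μ n D.u_bd p
  have hUt := moll_tendsto μ D.u_int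
  have hUt' : ∀ᵐ p ∂μ, Tendsto (fun n => moll μ n u (p + y)) atTop (𝓝 (u (p + y))) :=
    (quasiMeasurePreserving_add_right μ y).ae hUt
  obtain ⟨cf, hcf0, hcf⟩ := cont_bdd f hfC.continuous M
  obtain ⟨cf', hcf'0, hcf'⟩ := cont_bdd f' hf' M
  obtain ⟨cz, hcz0, hcz⟩ := cs_bdd ζ hζ.continuous hc
  have hζI : Integrable ζ μ := hζ.continuous.integrable_of_hasCompactSupport hc
  have L0 : Tendsto (fun n => ∫ p, |f (moll μ n u (p + y)) * ζ (p + y)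
      - f (moll μ n u p) * ζ p| ∂μ) atTop
      (𝓝 (∫ p, |f (u (p + y)) * ζ (p + y) - f (u p) * ζ p| ∂μ)) := by
    refine tendsto_integral_of_dominated_convergence (fun p => cf * |ζ (p + y)| + cf * |ζ p|)
      (fun n => ?_) (((hζI.comp_add_right y).abs.const_mul _).add (hζI.abs.const_mul _))
      (fun n => Eventually.of_forall fun p => ?_) ?_
    · have h1 : Continuous (fun p => f (moll μ n u p) * ζ p) :=
        (hfC.continuous.comp (hUc n)).mul hζ.continuous
      exact ((h1.comp (continuous_add_const y)).sub h1).abs.aestronglyMeasurable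
    · rw [Real.norm_eq_abs, abs_abs]
      refine (abs_sub _ _).trans (add_le_add ?_ ?_)
      · rw [abs_mul]; exact mul_le_mul_of_nonneg_right (hcf _ (hUb _ _)) (abs_nonneg _)
      · rw [abs_mul]; exact mul_le_mul_of_nonneg_right (hcf _ (hUb _ _)) (abs_nonneg _)
    · filter_upwards [hUt, hUt'] with p h1 h2
      exact ((((hfC.continuous.tendsto _).comp h2).mul tendsto_const_nhds).sub
        (((hfC.continuous.tendsto _).comp h1).mul tendsto_const_nhds)).abs
  have L1 : ∀ i, Tendsto (fun n => ∫ p, |moll μ n (Vc i) p * (f' (moll μ n u p) * ζ p)| ∂μ)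
      atTop (𝓝 (∫ p, |Vc i p * (f' (u p) * ζ p)| ∂μ)) := by
    intro i
    refine gdct μ (H := fun p => (cf' * cz) * |Vc i p|) ((D.V_int i).abs.const_mul _)
      (fun p => mul_nonneg (by positivity) (abs_nonneg _)) _ _ (fun n => ?_) (fun n p => ?_) ?_
    · exact ((hVc i n).mul ((hf'.comp (hUc n)).mul hζ.continuous)).abs.aestronglyMeasurable
    · rw [abs_abs, abs_mul, moll_const_mul]
      have h2 : |f' (moll μ n u p) * ζ p| ≤ cf' * cz := by
        rw [abs_mul]; exact mul_le_mul (hcf' _ (hUb n p)) (hcz p) (abs_nonneg _) hcf'0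
      calc _ ≤ (moll μ n (fun q => |Vc i q|) p) * (cf' * cz) :=
            mul_le_mul (moll_abs_le μ n _ p) h2 (abs_nonneg _)
            (moll_nonneg μ n (fun _ => abs_nonneg _) p)
        _ = _ := by ring
    · filter_upwards [hUt, moll_tendsto μ (D.V_int i)] with p h1 h2
      exact (h2.mul (((hf'.tendsto _).comp h1).mul tendsto_const_nhds)).abs
  have L2 : ∀ i, Tendsto (fun n => ∫ p, |f (moll μ n u p) * fderiv ℝ ζ p (e i)| ∂μ) atTop
      (𝓝 (∫ p, |f (u p) * fderiv ℝ ζ p (e i)| ∂μ)) := by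
    intro i
    refine tendsto_integral_of_dominated_convergence (fun p => cf * |fderiv ℝ ζ p (e i)|)
      (fun n => ((hfC.continuous.comp (hUc n)).mul (hdc (e i))).abs.aestronglyMeasurable)
      (((hdc (e i)).integrable_of_hasCompactSupport
        (hc.fderiv_apply (𝕜 := ℝ) (e i))).abs.const_mul _)
      (fun n => Eventually.of_forall fun p => ?_) ?_
    · rw [norm_abs_eq_norm, norm_mul]
      exact mul_le_mul_of_nonneg_right (hcf _ (hUb n p)) (abs_nonneg _)
    · filter_upwards [hUt] with p h1
      exact (((hfC.continuous.tendsto _).comp h1).mul tendsto_const_nhds).abs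
  refine le_of_tendsto_of_tendsto L0 (tendsto_finsetSum (Finset.univ) fun i _ =>
    ((L1 i).add (L2 i)).const_mul (|c i|)) ?_
  filter_upwards [D.near hc hs] with n hn
  have hψ : ContDiff ℝ 1 (fun p => f (moll μ n u p) * ζ p) := (hfC.comp (hUC n)).mul hζ
  have hψc : HasCompactSupport (fun p => f (moll μ n u p) * ζ p) := hc.mul_left
  refine (trans_smooth hψ hψc y).trans ?_
  have hJ1 : ∀ i, Integrable (fun p => |moll μ n (Vc i) p * (f' (moll μ n u p) * ζ p)|) μ :=
    fun i => (((hVc i n).mul ((hf'.comp (hUc n)).mul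
      hζ.continuous)).integrable_of_hasCompactSupport hc.mul_left.mul_left).abs
  have hJ2 : ∀ i, Integrable (fun p => |f (moll μ n u p) * fderiv ℝ ζ p (e i)|) μ :=
    fun i => (((hfC.continuous.comp (hUc n)).mul (hdc (e i))).integrable_of_hasCompactSupport
      (hc.fderiv_apply (𝕜 := ℝ) (e i)).mul_left).abs
  have hJ3 : ∀ i, Integrable (fun p => |c i| * (|moll μ n (Vc i) p * (f' (moll μ n u p) * ζ p)| +
        |f (moll μ n u p) * fderiv ℝ ζ p (e i)|)) μ :=
    fun i => ((hJ1 i).add (hJ2 i)).const_mul _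
  have e1 : ∑ i, |c i| * (∫ p, |moll μ n (Vc i) p * (f' (moll μ n u p) * ζ p)| ∂μ +
        ∫ p, |f (moll μ n u p) * fderiv ℝ ζ p (e i)| ∂μ) =
      ∫ p, ∑ i, |c i| * (|moll μ n (Vc i) p * (f' (moll μ n u p) * ζ p)| +
        |f (moll μ n u p) * fderiv ℝ ζ p (e i)|) ∂μ := by
    rw [integral_finsetSum _ (fun i _ => hJ3 i)]
    refine Finset.sum_congr rfl fun i _ => ?_
    rw [integral_const_mul, integral_add (hJ1 i) (hJ2 i)]
  rw [e1]
  apply integral_mono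
  · exact (((hψ.continuous_fderiv one_ne_zero).clm_apply
      continuous_const).integrable_of_hasCompactSupport (hψc.fderiv_apply (𝕜 := ℝ) y)).abs
  · exact integrable_finsetSum _ (fun i _ => hJ3 i)
  · intro p
    simp only
    rw [hy, map_sum]
    refine (Finset.abs_sum_le_sum_abs _ _).trans (Finset.sum_le_sum fun i _ => ?_)
    rw [map_smul, smul_eq_mul, abs_mul]
    refine mul_le_mul_of_nonneg_left ?_ (abs_nonneg _)
    rw [fderiv_comp_mul hf (hUC n) hζ]
    refine (abs_add_le _ _).trans (add_le_add (le_of_eq ?_) le_rfl)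
    by_cases hp : p ∈ tsupport ζ
    · rw [D.fderivV (hn p hp) i]; congr 1; ring
    · simp [image_eq_zero_of_notMem_tsupport hp]

end Ident

section GFun
/-- Structure of the nonlinearity, with an integer upper growth exponent. -/
structure GData (g G : ℝ → ℝ) (m : ℕ) : Prop where
  cont : Continuous g
  mono : MonotoneOn g (Set.Ici 0)
  nonneg : ∀ σ : ℝ, 0 ≤ σ → 0 ≤ g σ
  pos : ∀ σ : ℝ, 0 < σ → 0 < g σ
  eq : ∀ σ : ℝ, G σ = ∫ τ in (0:ℝ)..σ, g τ
  up : ∀ σ : ℝ, 0 < σ → σ * g σ ≤ m * G σ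

variable {g G : ℝ → ℝ} {m : ℕ}

lemma GData.hasDerivAt (D : GData g G m) (x : ℝ) : HasDerivAt G (g x) x := by
  have : G = fun σ => ∫ τ in (0:ℝ)..σ, g τ := funext D.eq
  rw [this]
  exact intervalIntegral.integral_hasDerivAt_right (D.cont.intervalIntegrable _ _)
    (D.cont.stronglyMeasurableAtFilter _ _) D.cont.continuousAt

lemma GData.continuous (D : GData g G m) : Continuous G :=
  continuous_iff_continuousAt.mpr fun x => (D.hasDerivAt x).continuousAt

lemma GData.zero (D : GData g G m) : G 0 = 0 := by rw [D.eq]; simp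

lemma GData.add_le (D : GData g G m) {r s : ℝ} (hr : 0 ≤ r) (hrs : r ≤ s) :
    G r + (s - r) * g r ≤ G s := by
  have h : G s - G r = ∫ τ in r..s, g τ := by
    rw [D.eq, D.eq, intervalIntegral.integral_interval_sub_left]
    · exact D.cont.intervalIntegrable _ _
    · exact D.cont.intervalIntegrable _ _
  have h2 : ∫ τ in r..s, g r ≤ ∫ τ in r..s, g τ := by
    apply intervalIntegral.integral_mono_on hrs (by simp) (D.cont.intervalIntegrable _ _)
    intro x hx
    exact D.mono (mem_Ici.mpr hr) (mem_Ici.mpr (hr.trans hx.1)) hx.1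
  rw [intervalIntegral.integral_const, smul_eq_mul] at h2
  linarith

lemma GData.monoG (D : GData g G m) {r s : ℝ} (hr : 0 ≤ r) (hrs : r ≤ s) : G r ≤ G s := by
  have := D.add_le hr hrs
  nlinarith [D.nonneg r hr]

lemma GData.G_nonneg (D : GData g G m) {s : ℝ} (hs : 0 ≤ s) : 0 ≤ G s := by
  have := D.monoG le_rfl hs
  rwa [D.zero] at this

lemma GData.G_pos (D : GData g G m) {s : ℝ} (hs : 0 < s) : 0 < G s := by
  have := D.add_le (half_pos hs).le (half_le_self hs.le)
  have h1 := D.pos _ (half_pos hs)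
  have h2 := D.G_nonneg (half_pos hs).le
  nlinarith

lemma GData.le_mul (D : GData g G m) {s : ℝ} (hs : 0 ≤ s) : G s ≤ s * g s := by
  have h : G s ≤ ∫ τ in (0:ℝ)..s, g s := by
    rw [D.eq]
    apply intervalIntegral.integral_mono_on hs (D.cont.intervalIntegrable _ _) (by simp)
    intro x hx
    exact D.mono (mem_Ici.mpr hx.1) (mem_Ici.mpr hs) hx.2
  rw [intervalIntegral.integral_const, smul_eq_mul] at h
  linarith

lemma GData.up' (D : GData g G m) {s : ℝ} (hs : 0 ≤ s) : s * g s ≤ m * G s := by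
  rcases hs.eq_or_lt with h | h
  · rw [← h, D.zero]; simp
  · exact D.up s h

lemma GData.lin (D : GData g G m) {r s : ℝ} (hr : 0 < r) (hs : 0 ≤ s) :
    s ≤ r * (1 + G s / G r) := by
  have hG := D.G_pos hr
  rcases le_total s r with h | h
  · have : 0 ≤ G s / G r := div_nonneg (D.G_nonneg hs) hG.le
    nlinarith
  · have h1 := D.add_le hr.le h
    have h2 := D.le_mul hr.le
    have h3 : s * G r ≤ r * G s := by nlinarith
    have h4 : s ≤ r * (G s / G r) := by
      rw [← mul_div_assoc, le_div_iff₀ hG]; exact h3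
    linarith

lemma GData.two (D : GData g G m) {r : ℝ} (hr : 0 < r) : 2 * G r ≤ G (2 * r) := by
  have h1 := D.add_le hr.le (by linarith : r ≤ 2 * r)
  have h2 := D.le_mul hr.le
  linarith

lemma GData.growth (D : GData g G m) {l s : ℝ} (hl : 1 ≤ l) (hs : 0 < s) :
    G (l * s) ≤ l ^ m * G s := by
  have hanti : AntitoneOn (fun x => G x / x ^ m) (Ioi (0:ℝ)) := by
    have hd : ∀ x : ℝ, 0 < x → HasDerivAt (fun x => G x / x ^ m)
        ((g x * x ^ m - G x * (m * x ^ (m - 1))) / (x ^ m) ^ 2) x := by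
      intro x hx
      exact (D.hasDerivAt x).div (hasDerivAt_pow m x) (pow_pos hx m).ne'
    apply antitoneOn_of_deriv_nonpos (convex_Ioi 0)
    · exact fun x hx => (hd x hx).continuousAt.continuousWithinAt
    · intro x hx
      rw [interior_Ioi] at hx
      exact (hd x hx).differentiableAt.differentiableWithinAt
    · intro x hx
      rw [interior_Ioi] at hx
      have hx : 0 < x := hx
      rw [(hd x hx).deriv]
      apply div_nonpos_of_nonpos_of_nonneg _ (by positivity)
      have hup := D.up x hx
      rcases Nat.eq_zero_or_pos m with h0 | h0
      · subst h0
        have := D.pos x hx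
        simp at hup; nlinarith
      · obtain ⟨j, rfl⟩ : ∃ j, m = j + 1 := ⟨m - 1, by omega⟩
        simp only [Nat.add_sub_cancel, pow_succ]
        have : 0 < x ^ j := pow_pos hx j
        nlinarith
  have h := hanti (mem_Ioi.mpr hs) (mem_Ioi.mpr (by positivity : 0 < l * s))
    (by nlinarith : s ≤ l * s)
  simp only at h
  rw [div_le_div_iff₀ (by positivity) (by positivity), mul_pow] at h
  have : 0 < s ^ m := by positivity
  nlinarith

lemma GData.young (D : GData g G m) {s t δ : ℝ} (hs : 0 ≤ s) (ht : 0 ≤ t) (hδ : 0 < δ) :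
    g s * t ≤ δ * m * G s + δ * m * G (t / δ) := by
  have h1 : 0 ≤ G s := D.G_nonneg hs
  have h2 : 0 ≤ G (t / δ) := D.G_nonneg (by positivity)
  have hm : (0:ℝ) ≤ m := Nat.cast_nonneg m
  have hgs := D.nonneg s hs
  rcases le_total t (δ * s) with h | h
  · have := D.up' hs
    have e1 : g s * t ≤ δ * (s * g s) := by nlinarith
    have e2 : δ * (s * g s) ≤ δ * (m * G s) := by gcongr
    have : 0 ≤ δ * m * G (t / δ) := by positivity
    linarith
  · have h3 : s ≤ t / δ := by rw [le_div_iff₀ hδ]; linarith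
    have h4 : g s ≤ g (t / δ) := D.mono hs (hs.trans h3) h3
    have h5 := D.up' (hs.trans h3)
    have e1 : g s * t ≤ δ * (t / δ * g (t / δ)) := by
      rw [← mul_assoc, mul_div_cancel₀ _ hδ.ne']; nlinarith
    have e2 : δ * (t / δ * g (t / δ)) ≤ δ * (m * G (t / δ)) := by gcongr
    have : 0 ≤ δ * m * G s := by positivity
    linarith
end GFun

section Build
open Filter Topology

variable {N : ℕ}

/-- Spatial directions in space-time. -/
def dirx (N : ℕ) (i : Fin N) : EuclideanSpace ℝ (Fin N) × ℝ := (EuclideanSpace.single i 1, 0)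
/-- Time direction. -/
def dirt (N : ℕ) : EuclideanSpace ℝ (Fin N) × ℝ := (0, 1)

instance haarXT (N : ℕ) :
    (volume : Measure (EuclideanSpace ℝ (Fin N) × ℝ)).IsAddHaarMeasure :=
  inferInstanceAs ((volume : Measure (EuclideanSpace ℝ (Fin N))).prod
    (volume : Measure ℝ)).IsAddHaarMeasure

lemma buildMData {C0 C1 : ℝ} {g G : ℝ → ℝ} {m : ℕ} (hC1 : 0 < C1) (D : GData g G m)
    {K : Set (EuclideanSpace ℝ (Fin N))} (hK : IsOpen K) (hKv : volume K < ⊤) {T0 T1 : ℝ}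
    (hT : T0 < T1)
    {u : EuclideanSpace ℝ (Fin N) → ℝ → ℝ}
    {V : EuclideanSpace ℝ (Fin N) → ℝ → EuclideanSpace ℝ (Fin N)}
    (h : IsBoundedWeakSolution N C0 C1 g G K T0 T1 u V) :
    ∃ (a : EuclideanSpace ℝ (Fin N) × ℝ → EuclideanSpace ℝ (Fin N)) 
      (H : EuclideanSpace ℝ (Fin N) × ℝ → ℝ) (M : ℝ),
      MData volume N (dirx N) (dirt N) (K ×ˢ Ioo T0 T1)
        ((K ×ˢ Ioo T0 T1).indicator fun p => u p.1 p.2)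
        (fun i => (K ×ˢ Ioo T0 T1).indicator fun p => V p.1 p.2 i)
        (fun i => (K ×ˢ Ioo T0 T1).indicator fun p => a p i) H M ∧
      Measurable a ∧
      (∀ᵐ p, p ∈ K ×ˢ Ioo T0 T1 →
        C0 * G ‖V p.1 p.2‖ ≤ ∑ i, a p i * V p.1 p.2 i ∧ ‖a p‖ ≤ C1 * g ‖V p.1 p.2‖) := by
  obtain ⟨a, ham, hab, haw⟩ := h.weak_form
  obtain ⟨M, hM⟩ := h.bounded
  set Q := K ×ˢ Ioo T0 T1 with hQ
  have hQo : IsOpen Q := hK.prod isOpen_Ioo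
  have hQm : MeasurableSet Q := hQo.measurableSet
  have hQv : volume Q < ⊤ := by
    rw [hQ, Measure.volume_eq_prod, Measure.prod_prod]
    exact ENNReal.mul_lt_top hKv (by simp)
  have hfin : IsFiniteMeasure (volume.restrict Q) := ⟨by simpa using hQv⟩
  have hGi := h.grad_G_integrable
  have hVm := h.grad_measurable
  -- integrability of components
  have hui : IntegrableOn (fun p : EuclideanSpace ℝ (Fin N) × ℝ => u p.1 p.2) Q := by
    refine Integrable.mono' (integrable_const M) (h.continuousOn.aestronglyMeasurable hQm) ?_
    exact (ae_restrict_iff' hQm).mpr (Eventually.of_forall fun p hp => hM p.1 hp.1 p.2 hp.2)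
  have hVi : ∀ i, IntegrableOn (fun p : EuclideanSpace ℝ (Fin N) × ℝ => V p.1 p.2 i) Q := by
    intro i
    refine Integrable.mono' (g := fun p => 1 * (1 + G ‖V p.1 p.2‖ / G 1))
      (((integrable_const 1).add (hGi.div_const _)).const_mul _) ?_ ?_
    · exact (by fun_prop : Measurable fun p : EuclideanSpace ℝ (Fin N) × ℝ =>
        V p.1 p.2 i).aestronglyMeasurable
    · exact Eventually.of_forall fun p => (PiLp.norm_apply_le _ i).trans
        (D.lin one_pos (norm_nonneg _))
  have hai : ∀ i, IntegrableOn (fun p : EuclideanSpace ℝ (Fin N) × ℝ => a p.1 p.2 i) Q := by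
    intro i
    refine Integrable.mono' (g := fun p => C1 * (g 1 + m * G ‖V p.1 p.2‖))
      (((integrable_const _).add (hGi.const_mul _)).const_mul _) ?_ ?_
    · exact (by fun_prop : Measurable fun p : EuclideanSpace ℝ (Fin N) × ℝ =>
        a p.1 p.2 i).aestronglyMeasurable
    · rw [ae_restrict_iff' hQm]
      filter_upwards [hab] with p hp hpQ
      refine (PiLp.norm_apply_le _ i).trans ((hp hpQ).2.trans ?_)
      gcongr
      have h0 := norm_nonneg (V p.1 p.2)
      have hg1 := D.nonneg 1 zero_le_one
      have hmG : 0 ≤ m * G ‖V p.1 p.2‖ := mul_nonneg (Nat.cast_nonneg _) (D.G_nonneg h0)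
      rcases le_total ‖V p.1 p.2‖ 1 with h1 | h1
      · have := D.mono h0 (zero_le_one (α := ℝ)) h1
        linarith
      · have h2 := D.up' h0
        have h3 := D.nonneg _ h0
        nlinarith
  refine ⟨fun p => a p.1 p.2, Q.indicator fun p => C1 * (m * G ‖V p.1 p.2‖), |M|,
    ⟨hQo, ?_, ?_, ?_, ?_, ?_, ?_, ?_, ?_, ?_⟩, ham, hab⟩
  · exact hui.integrable_indicator hQm
  · intro p
    by_cases hp : p ∈ Q
    · rw [indicator_of_mem hp]; exact (hM p.1 hp.1 p.2 hp.2).trans (le_abs_self M)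
    · rw [indicator_of_notMem hp]; simp
  · exact fun i => (hVi i).integrable_indicator hQm
  · exact fun i => (hai i).integrable_indicator hQm
  · exact IntegrableOn.integrable_indicator ((hGi.const_mul _).const_mul _) hQm
  · intro p
    refine indicator_nonneg (fun p _ => ?_) p
    exact mul_nonneg hC1.le (mul_nonneg (Nat.cast_nonneg _) (D.G_nonneg (norm_nonneg _)))
  · intro i
    filter_upwards [hab] with p hp q
    have hH : ∀ p, 0 ≤ Q.indicator
        (fun p : EuclideanSpace ℝ (Fin N) × ℝ => C1 * (m * G ‖V p.1 p.2‖)) p :=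
      indicator_nonneg (fun p _ =>
        mul_nonneg hC1.le (mul_nonneg (Nat.cast_nonneg _) (D.G_nonneg (norm_nonneg _))))
    by_cases hpQ : p ∈ Q
    · by_cases hqQ : q ∈ Q
      · simp only [indicator_of_mem hpQ, indicator_of_mem hqQ]
        have ha1 : |a p.1 p.2 i| ≤ C1 * g ‖V p.1 p.2‖ := (PiLp.norm_apply_le _ i).trans (hp hpQ).2
        have hv1 : |V q.1 q.2 i| ≤ ‖V q.1 q.2‖ := by
          rw [← Real.norm_eq_abs]; exact PiLp.norm_apply_le (V q.1 q.2) i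
        set s := ‖V p.1 p.2‖
        set r := ‖V q.1 q.2‖
        have hs : 0 ≤ s := norm_nonneg _
        have hr : 0 ≤ r := norm_nonneg _
        have e1 : |a p.1 p.2 i| * |V q.1 q.2 i| ≤ C1 * (g s * r) := by
          rw [← mul_assoc]
          exact mul_le_mul ha1 hv1 (abs_nonneg _) (mul_nonneg hC1.le (D.nonneg s hs))
        refine e1.trans ?_
        rw [← mul_add]
        refine mul_le_mul_of_nonneg_left ?_ hC1.le
        have u1 := D.up' hs
        have u2 := D.up' hr
        have n1 := D.nonneg s hs
        have n2 := D.nonneg r hr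
        rcases le_total r s with hrs | hrs
        · nlinarith
        · have := D.mono hs hr hrs
          nlinarith
      · simp only [indicator_of_notMem hqQ, abs_zero, mul_zero]
        exact add_nonneg (hH p) le_rfl
    · simp only [indicator_of_notMem hpQ, abs_zero, zero_mul]
      exact add_nonneg le_rfl (hH q)
  · intro φ hφ hφc hφs i
    have := h.weak_gradient φ hφ hφc hφs i
    rw [← integral_indicator hQm, ← integral_indicator hQm] at this
    have e1 : ∀ p, Q.indicator (fun p => u p.1 p.2) p * fderiv ℝ φ p (dirx N i) =
        Q.indicator (fun p => u p.1 p.2 * fderiv ℝ φ p (EuclideanSpace.single i 1, 0)) p := by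
      intro p; by_cases hp : p ∈ Q <;> simp [hp, dirx]
    have e2 : ∀ p, Q.indicator (fun p => V p.1 p.2 i) p * φ p =
        Q.indicator (fun p => V p.1 p.2 i * φ p) p := by
      intro p; by_cases hp : p ∈ Q <;> simp [hp]
    simp_rw [e1, e2]; exact this
  · intro φ hφ hφc hφs
    have hφ1 : ContDiff ℝ 1 φ := hφ.of_le (by exact_mod_cast le_top)
    have hdc : ∀ v, Continuous (fun p => fderiv ℝ φ p v) :=
      fun v => (hφ1.continuous_fderiv one_ne_zero).clm_apply continuous_const
    have hdb : ∀ v, ∃ c, ∀ p, ‖fderiv ℝ φ p v‖ ≤ c := fun v =>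
      (hφc.fderiv_apply (𝕜 := ℝ) v).exists_bound_of_continuous (hdc v)
    obtain ⟨L, hL⟩ := hφ1.lipschitzWith_of_hasCompactSupport hφc one_ne_zero
    have hvan : ∀ p, p ∉ Q → φ p = 0 := fun p hp =>
      image_eq_zero_of_notMem_tsupport fun hh => hp (hφs hh)
    have hw := haw (fun x t => φ (x, t)) ⟨L, hL⟩ ⟨(tsupport φ)ᶜ,
      (isClosed_tsupport φ).isOpen_compl, ?_, fun p hp => image_eq_zero_of_notMem_tsupport hp⟩
      T0 T1 le_rfl hT.le le_rfl
    swap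
    · intro p hp hps
      have hpQ := hφs hps
      rcases hp with hp | hp
      · exact (hK.frontier_eq ▸ hp.1).2 hpQ.1
      · have := hpQ.2.1
        rw [mem_singleton_iff.mp hp.2] at this
        exact lt_irrefl _ this
    have z1 : ∀ x, φ (x, T1) = 0 := fun x => hvan _ (fun hh => lt_irrefl _ hh.2.2)
    have z0 : ∀ x, φ (x, T0) = 0 := fun x => hvan _ (fun hh => lt_irrefl _ hh.2.1)
    simp only [z1, z0, mul_zero, integral_zero, sub_self] at hw
    have d1 : ∀ x t, deriv (fun t => φ (x, t)) t = fderiv ℝ φ (x, t) (dirt N) := by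
      intro x t
      have h2 : HasDerivAt (fun t : ℝ => (x, t)) ((0, 1) : EuclideanSpace ℝ (Fin N) × ℝ) t :=
        (hasDerivAt_const t x).prodMk (hasDerivAt_id t)
      exact ((hφ1.differentiable one_ne_zero _).hasFDerivAt.comp_hasDerivAt t h2).deriv
    have d2 : ∀ x t i, fderiv ℝ (fun y => φ (y, t)) x (EuclideanSpace.single i 1) =
        fderiv ℝ φ (x, t) (dirx N i) := by
      intro x t i
      have h2 : HasFDerivAt (fun y : EuclideanSpace ℝ (Fin N) => (y, t))
        ((ContinuousLinearMap.id ℝ _).prod 0) x :=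
        (hasFDerivAt_id x).prodMk (hasFDerivAt_const t x)
      have := ((hφ1.differentiable one_ne_zero (x, t)).hasFDerivAt.comp x h2).fderiv
      rw [Function.comp_def] at this
      rw [this]; simp [dirx]
    simp only [d1, d2] at hw
    have i1 : ∀ (f : EuclideanSpace ℝ (Fin N) × ℝ → ℝ) (v), IntegrableOn f Q →
        IntegrableOn (fun p => f p * fderiv ℝ φ p v) Q := by
      intro f v hf
      obtain ⟨c, hc⟩ := hdb v
      exact Integrable.mul_bdd (c := c) hf (hdc v).aestronglyMeasurable
        (Eventually.of_forall hc)
    have hint : IntegrableOn (fun p : EuclideanSpace ℝ (Fin N) × ℝ =>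
        u p.1 p.2 * fderiv ℝ φ p (dirt N) - ∑ i, a p.1 p.2 i * fderiv ℝ φ p (dirx N i)) Q :=
      (i1 _ _ hui).sub (integrable_finsetSum _ fun i _ => i1 _ _ (hai i))
    have hQr : (volume : Measure (EuclideanSpace ℝ (Fin N) × ℝ)).restrict Q =
        (volume.restrict K).prod (volume.restrict (Ioo T0 T1)) := by
      rw [Measure.prod_restrict]; rfl
    have hz : ∫ p in Q, (u p.1 p.2 * fderiv ℝ φ p (dirt N)
        - ∑ i, a p.1 p.2 i * fderiv ℝ φ p (dirx N i)) = 0 := by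
      have hint' := hint
      rw [IntegrableOn, hQr] at hint'
      rw [hQr, integral_prod_symm _ hint', hw, intervalIntegral.integral_of_le hT.le,
        integral_Ioc_eq_integral_Ioo]
    rw [integral_sub (i1 _ _ hui) (integrable_finsetSum _ fun i _ => i1 _ _ (hai i)),
      integral_finsetSum _ (fun i _ => i1 _ _ (hai i)), sub_eq_zero] at hz
    have e1 : ∀ (f : EuclideanSpace ℝ (Fin N) × ℝ → ℝ) v, 
        ∫ p, Q.indicator f p * fderiv ℝ φ p v = ∫ p in Q, f p * fderiv ℝ φ p v := by
      intro f v
      rw [← integral_indicator hQm]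
      congr 1; ext p; by_cases hp : p ∈ Q <;> simp [hp]
    rw [e1, hz]
    exact Finset.sum_congr rfl fun i _ => (e1 _ _).symm
end Build

section Trunc
open Filter Topology

lemma maxpow_hasDerivAt (n : ℕ) (y : ℝ) :
    HasDerivAt (fun y : ℝ => (max y 0) ^ (n + 2)) ((n + 2) * (max y 0) ^ (n + 1)) y := by
  rcases lt_trichotomy y 0 with h | h | h
  · have : (fun y : ℝ => (max y 0) ^ (n + 2)) =ᶠ[𝓝 y] fun _ => 0 := by
      filter_upwards [gt_mem_nhds h] with z hz
      rw [max_eq_right hz.le]; simp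
    rw [max_eq_right h.le]
    simpa using (hasDerivAt_const y (0:ℝ)).congr_of_eventuallyEq this
  · subst h
    have : (fun y : ℝ => (max y 0) ^ (n + 2)) =O[𝓝 0] fun x => ‖x - 0‖ ^ (n + 2) := by
      refine Asymptotics.IsBigO.of_bound 1 (Eventually.of_forall fun x => ?_)
      rw [sub_zero, one_mul, norm_pow, norm_pow, norm_norm]
      refine pow_le_pow_left₀ (norm_nonneg _) ?_ _
      rw [Real.norm_eq_abs, Real.norm_eq_abs]
      rcases le_total x 0 with h | h
      · rw [max_eq_right h]; simp
      · rw [max_eq_left h]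
    have := (this.hasFDerivAt (by omega)).hasDerivAt
    simpa using this
  · have : (fun y : ℝ => (max y 0) ^ (n + 2)) =ᶠ[𝓝 y] fun y => y ^ (n + 2) := by
      filter_upwards [lt_mem_nhds h] with z hz
      rw [max_eq_left hz.le]
    rw [max_eq_left h.le]
    have h2 := (hasDerivAt_pow (n + 2) y).congr_of_eventuallyEq this
    simpa using h2

/-- Truncation. -/
def trc (c s : ℝ) : ℝ := max (c - s) 0

lemma trc_nonneg (c s : ℝ) : 0 ≤ trc c s := le_max_right _ _
lemma trc_cont (c : ℝ) : Continuous (trc c) := by unfold trc; fun_prop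
lemma trc_le {c s k : ℝ} (hs : 0 ≤ s) (hc : c ≤ k) (hk : 0 ≤ k) : trc c s ≤ k :=
  max_le (by linarith) hk
lemma trc_zero {c s : ℝ} (h : c ≤ s) : trc c s = 0 := max_eq_right (by linarith)

lemma trc_pow_hasDerivAt (n : ℕ) (c s : ℝ) :
    HasDerivAt (fun s => trc c s ^ (n + 2)) (-((n + 2) * trc c s ^ (n + 1))) s := by
  have h := (maxpow_hasDerivAt n (c - s)).comp s ((hasDerivAt_id s).const_sub c)
  simpa [Function.comp_def, trc] using h

lemma trc_F (c s : ℝ) : HasDerivAt (fun s => trc c s ^ 3 / 3) (-(trc c s ^ 2)) s := by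
  have h := (trc_pow_hasDerivAt 1 c s).div_const 3
  exact h.congr_deriv (by push_cast; ring)

lemma trc_f (c s : ℝ) : HasDerivAt (fun s => -(trc c s ^ 2)) (2 * trc c s) s := by
  have h := (trc_pow_hasDerivAt 0 c s).neg
  exact h.congr_deriv (by push_cast; ring)

lemma trc_h (c s : ℝ) : HasDerivAt (fun s => trc c s ^ 3) (-(3 * trc c s ^ 2)) s := by
  have h := (trc_pow_hasDerivAt 1 c s)
  exact h.congr_deriv (by push_cast; ring)

end Trunc

section Cutoff
open Filter Topology

/-- derivative of the smooth transition -/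
def dS (x : ℝ) : ℝ := deriv Real.smoothTransition x

lemma dS_cont : Continuous dS :=
  (Real.smoothTransition.contDiff (n := 1)).continuous_deriv (le_refl _)

lemma S_hasDerivAt (x : ℝ) : HasDerivAt Real.smoothTransition (dS x) x :=
  ((Real.smoothTransition.contDiff (n := 1)).differentiable one_ne_zero x).hasDerivAt

lemma dS_zero {x : ℝ} (h : x ≤ 0 ∨ 1 ≤ x) : dS x = 0 := by
  have : IsLocalExtr Real.smoothTransition x := by
    rcases h with h | h
    · left
      exact Eventually.of_forall fun y => by
        rw [Real.smoothTransition.zero_of_nonpos h]; exact Real.smoothTransition.nonneg y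
    · right
      exact Eventually.of_forall fun y => by
        rw [Real.smoothTransition.one_of_one_le h]; exact Real.smoothTransition.le_one y
  exact this.deriv_eq_zero

lemma dS_bdd : ∃ c, 1 ≤ c ∧ ∀ x, |dS x| ≤ c := by
  obtain ⟨c, hc⟩ := (isCompact_Icc (a := (0:ℝ)) (b := 1)).exists_bound_of_continuousOn
    dS_cont.continuousOn
  refine ⟨max c 1, le_max_right _ _, fun x => ?_⟩
  by_cases h : x ∈ Icc (0:ℝ) 1
  · exact (hc x h).trans (le_max_left _ _)
  · have : x ≤ 0 ∨ 1 ≤ x := by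
      by_contra hh; push Not at hh; exact h ⟨hh.1.le, hh.2.le⟩
    rw [dS_zero this]; simp

lemma dS_nonneg (x : ℝ) : 0 ≤ dS x := by
  exact Real.smoothTransition.monotone.deriv_nonneg 

/-- A bound for the derivative of the smooth transition. -/
def cS : ℝ := dS_bdd.choose
lemma cS_one : 1 ≤ cS := dS_bdd.choose_spec.1
lemma dS_le (x : ℝ) : |dS x| ≤ cS := dS_bdd.choose_spec.2 x

/-- rising ramp: 0 before `a`, 1 after `b`. -/
def rampU (a b t : ℝ) : ℝ := Real.smoothTransition ((t - a) / (b - a))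
/-- its derivative -/
def rampU' (a b t : ℝ) : ℝ := dS ((t - a) / (b - a)) / (b - a)

lemma rampU_contDiff (a b : ℝ) : ContDiff ℝ 1 (rampU a b) := by
  unfold rampU
  exact Real.smoothTransition.contDiff.comp (by fun_prop)
lemma rampU_hasDerivAt (a b t : ℝ) : HasDerivAt (rampU a b) (rampU' a b t) t := by
  have h := (S_hasDerivAt ((t - a) / (b - a))).comp t
    (((hasDerivAt_id t).sub_const a).div_const (b - a))
  exact h.congr_deriv (by simp [rampU', div_eq_mul_inv])
lemma rampU_nonneg (a b t : ℝ) : 0 ≤ rampU a b t := Real.smoothTransition.nonneg _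
lemma rampU_le_one (a b t : ℝ) : rampU a b t ≤ 1 := Real.smoothTransition.le_one _
lemma rampU_zero {a b t : ℝ} (hab : a < b) (h : t ≤ a) : rampU a b t = 0 :=
  Real.smoothTransition.zero_of_nonpos (div_nonpos_of_nonpos_of_nonneg (by linarith) (by linarith))
lemma rampU_one {a b t : ℝ} (hab : a < b) (h : b ≤ t) : rampU a b t = 1 :=
  Real.smoothTransition.one_of_one_le (by rw [le_div_iff₀ (by linarith)]; linarith)
lemma rampU'_nonneg {a b : ℝ} (hab : a < b) (t : ℝ) : 0 ≤ rampU' a b t :=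
  div_nonneg (dS_nonneg _) (by linarith)
lemma rampU'_le {a b : ℝ} (hab : a < b) (t : ℝ) : rampU' a b t ≤ cS / (b - a) :=
  div_le_div_of_nonneg_right ((le_abs_self _).trans (dS_le _)) (by linarith)
lemma rampU'_zero {a b t : ℝ} (hab : a < b) (h : t ≤ a ∨ b ≤ t) : rampU' a b t = 0 := by
  unfold rampU'
  rw [dS_zero, zero_div]
  rcases h with h | h
  · left; exact div_nonpos_of_nonpos_of_nonneg (by linarith) (by linarith)
  · right; rw [le_div_iff₀ (by linarith)]; linarith
lemma rampU'_cont (a b : ℝ) : Continuous (rampU' a b) := by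
  unfold rampU'; exact (dS_cont.comp (by fun_prop)).div_const _

/-- one-dimensional space cutoff -/
def bumpS (a b y : ℝ) : ℝ := rampU (-b) (-a) y * (1 - rampU a b y)
/-- its derivative -/
def bumpS' (a b y : ℝ) : ℝ :=
  rampU' (-b) (-a) y * (1 - rampU a b y) + rampU (-b) (-a) y * (-rampU' a b y)

lemma bumpS_contDiff (a b : ℝ) : ContDiff ℝ 1 (bumpS a b) :=
  (rampU_contDiff _ _).mul (contDiff_const.sub (rampU_contDiff _ _))
lemma bumpS_hasDerivAt (a b t : ℝ) : HasDerivAt (bumpS a b) (bumpS' a b t) t :=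
  (rampU_hasDerivAt _ _ _).mul ((rampU_hasDerivAt _ _ _).const_sub 1)
lemma bumpS_nonneg (a b t : ℝ) : 0 ≤ bumpS a b t :=
  mul_nonneg (rampU_nonneg _ _ _) (by linarith [rampU_le_one a b t])
lemma bumpS_le_one (a b t : ℝ) : bumpS a b t ≤ 1 :=
  mul_le_one₀ (rampU_le_one _ _ _) (by linarith [rampU_le_one a b t])
    (by linarith [rampU_nonneg a b t])
lemma bumpS_one {a b t : ℝ} (hab : a < b) (h : |t| ≤ a) : bumpS a b t = 1 := by
  rw [abs_le] at h
  rcases h.2.lt_or_eq with h2 | h2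
  · rw [bumpS, rampU_one (by linarith) h.1, rampU_zero hab h.2]; ring
  · rw [bumpS, rampU_one (by linarith) h.1, rampU_zero hab h.2]; ring
lemma bumpS_zero {a b t : ℝ} (hab : a < b) (h : b ≤ |t|) : bumpS a b t = 0 := by
  rcases le_abs.mp h with h | h
  · rw [bumpS, rampU_one hab h]; ring
  · rw [bumpS, rampU_zero (by linarith) (by linarith)]; ring
lemma bumpS'_le {a b : ℝ} (hab : a < b) (t : ℝ) : |bumpS' a b t| ≤ 2 * cS / (b - a) := by
  have h1 := rampU'_nonneg (a := -b) (b := -a) (by linarith) t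
  have h2 := rampU'_le (a := -b) (b := -a) (by linarith) t
  have h3 := rampU'_nonneg hab t
  have h4 := rampU'_le hab t
  have e : -a - -b = b - a := by ring
  rw [e] at h2
  unfold bumpS'
  have u0 := rampU_nonneg a b t
  have u1 := rampU_le_one a b t
  have w0 := rampU_nonneg (-b) (-a) t
  have w1 := rampU_le_one (-b) (-a) t
  have : 2 * cS / (b - a) = cS / (b - a) + cS / (b - a) := by ring
  rw [this]
  refine (abs_add_le _ _).trans (add_le_add ?_ ?_)
  · rw [abs_of_nonneg (mul_nonneg h1 (by linarith))]
    nlinarith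
  · rw [abs_mul, abs_neg, abs_of_nonneg w0, abs_of_nonneg h3]
    nlinarith

variable {N : ℕ}

/-- space cutoff -/
def spc (N : ℕ) (a b : ℝ) (x : EuclideanSpace ℝ (Fin N)) : ℝ := ∏ i, bumpS a b (x i)

lemma spc_nonneg (a b : ℝ) (x : EuclideanSpace ℝ (Fin N)) : 0 ≤ spc N a b x :=
  Finset.prod_nonneg fun _ _ => bumpS_nonneg _ _ _
lemma spc_le_one (a b : ℝ) (x : EuclideanSpace ℝ (Fin N)) : spc N a b x ≤ 1 :=
  Finset.prod_le_one (fun _ _ => bumpS_nonneg _ _ _) fun _ _ => bumpS_le_one _ _ _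
lemma spc_one {a b : ℝ} (hab : a < b) {x : EuclideanSpace ℝ (Fin N)} (h : ∀ i, |x i| ≤ a) :
    spc N a b x = 1 := Finset.prod_eq_one fun i _ => bumpS_one hab (h i)
lemma spc_zero {a b : ℝ} (hab : a < b) {x : EuclideanSpace ℝ (Fin N)} (h : ¬ ∀ i, |x i| ≤ b) :
    spc N a b x = 0 := by
  push Not at h
  obtain ⟨i, hi⟩ := h
  exact Finset.prod_eq_zero (Finset.mem_univ i) (bumpS_zero hab hi.le)
lemma spc_contDiff (a b : ℝ) : ContDiff ℝ 1 (spc N a b) := by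
  unfold spc
  exact contDiff_prod fun i _ => (bumpS_contDiff a b).comp
    (EuclideanSpace.proj (𝕜 := ℝ) i).contDiff

lemma spc_hasFDerivAt (a b : ℝ) (x : EuclideanSpace ℝ (Fin N)) :
    HasFDerivAt (spc N a b) (∑ i, (∏ j ∈ Finset.univ.erase i, bumpS a b (x j)) •
      (bumpS' a b (x i) • (EuclideanSpace.proj (𝕜 := ℝ) i))) x := by
  unfold spc
  have h : ∀ i, HasFDerivAt (fun x : EuclideanSpace ℝ (Fin N) => bumpS a b (x i))
      (bumpS' a b (x i) • (EuclideanSpace.proj (𝕜 := ℝ) i)) x := fun i =>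
    HasDerivAt.comp_hasFDerivAt (h₂ := bumpS a b) (f := fun x : EuclideanSpace ℝ (Fin N) => x i) x
      (bumpS_hasDerivAt a b (x i)) (EuclideanSpace.proj (𝕜 := ℝ) i).hasFDerivAt
  exact HasFDerivAt.finsetProd (fun i _ => h i)

lemma spc_fderiv_le {a b : ℝ} (hab : a < b) (x : EuclideanSpace ℝ (Fin N)) (i : Fin N) :
    |fderiv ℝ (spc N a b) x (EuclideanSpace.single i 1)| ≤ 2 * cS / (b - a) := by
  rw [(spc_hasFDerivAt a b x).fderiv]
  have : (∑ i, (∏ j ∈ Finset.univ.erase i, bumpS a b (x j)) •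
      (bumpS' a b (x i) • (EuclideanSpace.proj (𝕜 := ℝ) i : EuclideanSpace ℝ (Fin N) →L[ℝ] ℝ)))
      (EuclideanSpace.single i 1) =
      (∏ j ∈ Finset.univ.erase i, bumpS a b (x j)) * bumpS' a b (x i) := by
    rw [sum_apply, Finset.sum_eq_single i]
    · simp
    · intro j _ hj
      simp [hj]
    · simp
  rw [this, abs_mul, abs_of_nonneg (Finset.prod_nonneg fun _ _ => bumpS_nonneg _ _ _)]
  have h1 : ∏ j ∈ Finset.univ.erase i, bumpS a b (x j) ≤ 1 :=
    Finset.prod_le_one (fun _ _ => bumpS_nonneg _ _ _) fun _ _ => bumpS_le_one _ _ _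
  have h2 := bumpS'_le hab (x i)
  have := mul_le_mul h1 h2 (abs_nonneg _) zero_le_one
  simpa using this

/-- time cutoff -/
def tmc (a b c d t : ℝ) : ℝ := rampU a b t * (1 - rampU c d t)
/-- derivative of time cutoff -/
def tmc' (a b c d t : ℝ) : ℝ := rampU' a b t * (1 - rampU c d t) + rampU a b t * (-rampU' c d t)

lemma tmc_hasDerivAt (a b c d t : ℝ) : HasDerivAt (tmc a b c d) (tmc' a b c d t) t :=
  (rampU_hasDerivAt _ _ _).mul ((rampU_hasDerivAt _ _ _).const_sub 1)
lemma tmc_contDiff (a b c d : ℝ) : ContDiff ℝ 1 (tmc a b c d) :=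
  (rampU_contDiff _ _).mul (contDiff_const.sub (rampU_contDiff _ _))
lemma tmc_nonneg (a b c d t : ℝ) : 0 ≤ tmc a b c d t :=
  mul_nonneg (rampU_nonneg _ _ _) (by linarith [rampU_le_one c d t])
lemma tmc_le_one (a b c d t : ℝ) : tmc a b c d t ≤ 1 :=
  mul_le_one₀ (rampU_le_one _ _ _) (by linarith [rampU_le_one c d t])
    (by linarith [rampU_nonneg c d t])
lemma tmc_zero {a b c d t : ℝ} (hab : a < b) (hcd : c < d) (h : t ∉ Icc a d) :
    tmc a b c d t = 0 := by
  by_cases h1 : a ≤ t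
  · have : d ≤ t := by by_contra h2; exact h ⟨h1, (not_le.mp h2).le⟩
    rw [tmc, rampU_one hcd this]; ring
  · rw [tmc, rampU_zero hab (not_le.mp h1).le]; ring
lemma tmc_one {a b c d t : ℝ} (hab : a < b) (hcd : c < d) (h : b ≤ t) (h' : t ≤ c) :
    tmc a b c d t = 1 := by
  rw [tmc, rampU_one hab h, rampU_zero hcd h']; ring

/-- full cutoff -/
def ctf (N m : ℕ) (r s a b c d : ℝ) (p : EuclideanSpace ℝ (Fin N) × ℝ) : ℝ :=
  spc N r s p.1 ^ m * tmc a b c d p.2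

variable {m : ℕ} {r s a b c d : ℝ}

lemma ctf_nonneg (p) : 0 ≤ ctf N m r s a b c d p :=
  mul_nonneg (pow_nonneg (spc_nonneg _ _ _) _) (tmc_nonneg _ _ _ _ _)
lemma ctf_le_one (p) : ctf N m r s a b c d p ≤ 1 :=
  mul_le_one₀ (pow_le_one₀ (spc_nonneg _ _ _) (spc_le_one _ _ _)) (tmc_nonneg _ _ _ _ _)
    (tmc_le_one _ _ _ _ _)
lemma ctf_contDiff : ContDiff ℝ 1 (ctf N m r s a b c d) :=
  (((spc_contDiff r s).comp contDiff_fst).pow m).mul ((tmc_contDiff a b c d).comp contDiff_snd)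

lemma ctf_hasFDerivAt (p : EuclideanSpace ℝ (Fin N) × ℝ) :
    HasFDerivAt (ctf N m r s a b c d)
      ((spc N r s p.1 ^ m) • (tmc' a b c d p.2 • ContinuousLinearMap.snd ℝ _ _) +
       (tmc a b c d p.2) • ((m * spc N r s p.1 ^ (m - 1)) •
        ((fderiv ℝ (spc N r s) p.1).comp (ContinuousLinearMap.fst ℝ _ _)))) p := by
  have h1 : HasFDerivAt (fun p : EuclideanSpace ℝ (Fin N) × ℝ => spc N r s p.1)
      ((fderiv ℝ (spc N r s) p.1).comp (ContinuousLinearMap.fst ℝ _ _)) p :=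
    (((spc_contDiff r s).differentiable one_ne_zero) p.1).hasFDerivAt.comp p hasFDerivAt_fst
  have h2 : HasFDerivAt (fun p : EuclideanSpace ℝ (Fin N) × ℝ => tmc a b c d p.2)
      (tmc' a b c d p.2 • ContinuousLinearMap.snd ℝ _ _) p :=
    (tmc_hasDerivAt a b c d p.2).comp_hasFDerivAt p hasFDerivAt_snd
  have h3 := (h1.pow m).mul h2
  exact h3.congr_fderiv (by simp only [nsmul_eq_mul])

lemma ctf_fderiv_t (p) :
    fderiv ℝ (ctf N m r s a b c d) p (dirt N) = spc N r s p.1 ^ m * tmc' a b c d p.2 := by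
  rw [(ctf_hasFDerivAt p).fderiv]; simp [dirt]

lemma ctf_fderiv_x (hrs : r < s) (p) (i) :
    |fderiv ℝ (ctf N m r s a b c d) p (dirx N i)| ≤
      m * (2 * cS / (s - r)) * (spc N r s p.1 ^ (m - 1) * tmc a b c d p.2) := by
  rw [(ctf_hasFDerivAt p).fderiv]
  have h := spc_fderiv_le hrs p.1 i
  simp only [dirx, add_apply, smul_apply,
    ContinuousLinearMap.comp_apply, ContinuousLinearMap.coe_fst', ContinuousLinearMap.coe_snd',
    smul_eq_mul, mul_zero, zero_add]
  have t0 := tmc_nonneg a b c d p.2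
  have s0 := pow_nonneg (spc_nonneg (N := N) r s p.1) (m - 1)
  rw [abs_mul, abs_mul, abs_of_nonneg t0, abs_of_nonneg (mul_nonneg (Nat.cast_nonneg _) s0)]
  have := mul_le_mul_of_nonneg_left h (mul_nonneg t0 (mul_nonneg (Nat.cast_nonneg m) s0))
  calc _ = _ := (mul_assoc _ _ _).symm
    _ ≤ _ := this
    _ = _ := by ring

/-- closed box -/
def cbox (N : ℕ) (s : ℝ) : Set (EuclideanSpace ℝ (Fin N)) := {x | ∀ i, |x i| ≤ s}

lemma cbox_compact (s : ℝ) : IsCompact (cbox N s) := by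
  refine Metric.isCompact_of_isClosed_isBounded ?_ ?_
  · simp only [cbox, Set.ofPred_forall]
    refine isClosed_iInter fun i => isClosed_le (by fun_prop) continuous_const
  · refine (Metric.isBounded_iff_subset_closedBall 0).mpr ⟨∑ _i : Fin N, s, fun x hx => ?_⟩
    rw [mem_closedBall_zero_iff]
    have : ‖x‖ ≤ ∑ i, ‖x i‖ := by
      have h1 : x = ∑ i, x i • EuclideanSpace.single i (1:ℝ) := by
        ext j; simp [Finset.sum_apply, Pi.single_apply]
      calc ‖x‖ = ‖∑ i, x i • EuclideanSpace.single i (1:ℝ)‖ := by rw [← h1]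
        _ ≤ ∑ i, ‖x i • EuclideanSpace.single i (1:ℝ)‖ := norm_sum_le _ _
        _ = _ := by simp [norm_smul]
    exact this.trans (Finset.sum_le_sum fun i _ => hx i)

lemma ctf_zero (hm : m ≠ 0) (hrs : r < s) (hab : a < b) (hcd : c < d)
    {p : EuclideanSpace ℝ (Fin N) × ℝ} (hp : p ∉ cbox N s ×ˢ Icc a d) :
    ctf N m r s a b c d p = 0 := by
  by_cases h : p.1 ∈ cbox N s
  · rw [ctf, tmc_zero hab hcd (fun h2 => hp ⟨h, h2⟩), mul_zero]
  · rw [ctf, spc_zero hrs h, zero_pow hm, zero_mul]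

lemma ctf_tsupport (hm : m ≠ 0) (hrs : r < s) (hab : a < b) (hcd : c < d) :
    tsupport (ctf N m r s a b c d) ⊆ cbox N s ×ˢ Icc a d := by
  refine closure_minimal ?_ ((cbox_compact s).isClosed.prod isClosed_Icc)
  intro p hp
  by_contra h
  exact hp (ctf_zero hm hrs hab hcd h)

lemma ctf_compact (hm : m ≠ 0) (hrs : r < s) (hab : a < b) (hcd : c < d) :
    HasCompactSupport (ctf N m r s a b c d) :=
  HasCompactSupport.of_support_subset_isCompact ((cbox_compact s).prod isCompact_Icc)
    ((subset_tsupport _).trans (ctf_tsupport hm hrs hab hcd))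

end Cutoff

section Energy
open Filter Topology

/-- constant -/
def c4 (N m : ℕ) (C0 C1 : ℝ) : ℝ := max 1 (C1 * N * m * (4 * cS) / (C0 / m))
/-- constant -/
def c5 (N m : ℕ) (C0 C1 : ℝ) : ℝ := C0 * c4 N m C0 C1 ^ m
/-- constant -/
def c2 (N m : ℕ) (C0 C1 θ : ℝ) : ℝ := c5 N m C0 C1 + cS / θ

lemma young_pt {g G : ℝ → ℝ} {m : ℕ} (GD : GData g G m) (N : ℕ) {C0 C1 k P κ s v ξ χ : ℝ}
    (hm : 2 ≤ m) (hC0 : 0 < C0) (hC1 : 0 < C1) (hk : 0 < k) (hP : 0 < P) (hκ : 0 < κ) (hκ1 : κ ≤ 1)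
    (hs : 0 ≤ s) (hv : 0 ≤ v) (hvk : v ≤ k) (hξ : 0 ≤ ξ) (hξ1 : ξ ≤ 1) (hχ : 0 ≤ χ) (hχ1 : χ ≤ 1) :
    (C1 * g s) * v ^ 2 * (N * (m * (4 * cS / (κ * P)) * (ξ ^ (m - 1) * χ))) ≤
      C0 * (G s * (v * (ξ ^ m * χ))) + c5 N m C0 C1 * (κ ^ m)⁻¹ * k * G (k / P) := by
  have hγ : 0 < G (k / P) := GD.G_pos (by positivity)
  have hGs : 0 ≤ G s := GD.G_nonneg hs
  have h41 : 1 ≤ c4 N m C0 C1 := le_max_left _ _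
  have h4p : 0 < c4 N m C0 C1 := by linarith
  have h5p : 0 ≤ c5 N m C0 C1 := by unfold c5; positivity
  have hR : 0 ≤ C0 * (G s * (v * (ξ ^ m * χ))) + c5 N m C0 C1 * (κ ^ m)⁻¹ * k * G (k / P) := by
    positivity
  rcases hξ.eq_or_lt with h0 | h0
  · rw [← h0, zero_pow (by omega : m - 1 ≠ 0)] 
    rw [← h0] at hR
    simpa using hR
  have hmp : (0:ℝ) < m := by exact_mod_cast (by omega : 0 < m)
  have hcS : 0 < cS := by linarith [cS_one]
  set δ := C0 / m with hδ
  have hδp : 0 < δ := by positivity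
  have hδm : δ * m = C0 := by rw [hδ]; field_simp
  set t := C1 * N * m * (4 * cS) / (κ * P) * v / ξ with ht
  have htn : 0 ≤ t := by positivity
  have hy := GD.young hs htn hδp
  rw [hδm] at hy
  have hl : 1 ≤ c4 N m C0 C1 / (κ * ξ) := by
    rw [le_div_iff₀ (by positivity)]; nlinarith
  have htl : t / δ ≤ c4 N m C0 C1 / (κ * ξ) * (k / P) := by
    have : C1 * N * m * (4 * cS) / δ ≤ c4 N m C0 C1 := le_max_right _ _
    calc t / δ = (C1 * N * m * (4 * cS) / δ) * v / (κ * ξ * P) := by rw [ht]; field_simp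
      _ ≤ c4 N m C0 C1 * k / (κ * ξ * P) := by gcongr
      _ = _ := by field_simp
  have hG : G (t / δ) ≤ (c4 N m C0 C1 / (κ * ξ)) ^ m * G (k / P) :=
    (GD.monoG (by positivity) htl).trans (GD.growth hl (by positivity))
  have e1 : (C1 * g s) * v ^ 2 * (N * (m * (4 * cS / (κ * P)) * (ξ ^ (m - 1) * χ))) =
      (g s * t) * (v * (ξ ^ m * χ)) := by
    have : ξ ^ m = ξ ^ (m - 1) * ξ := by rw [← pow_succ]; congr 1; omega
    rw [this, ht]; field_simp
  rw [e1]
  have hw : 0 ≤ v * (ξ ^ m * χ) := by positivity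
  have h2 : (g s * t) * (v * (ξ ^ m * χ)) ≤
      (C0 * G s + C0 * ((c4 N m C0 C1 / (κ * ξ)) ^ m * G (k / P))) * (v * (ξ ^ m * χ)) := by
    refine mul_le_mul_of_nonneg_right (hy.trans ?_) hw
    have := mul_le_mul_of_nonneg_left hG hC0.le
    linarith
  refine h2.trans ?_
  have e2 : C0 * ((c4 N m C0 C1 / (κ * ξ)) ^ m * G (k / P)) * (v * (ξ ^ m * χ)) =
      c5 N m C0 C1 * (κ ^ m)⁻¹ * (v * χ) * G (k / P) := by
    unfold c5; rw [div_pow, mul_pow]; field_simp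
  have h3 : c5 N m C0 C1 * (κ ^ m)⁻¹ * (v * χ) * G (k / P) ≤
      c5 N m C0 C1 * (κ ^ m)⁻¹ * k * G (k / P) := by
    have : v * χ ≤ k := by nlinarith
    gcongr
  rw [add_mul, e2]
  linarith [h3, mul_assoc C0 (G s) (v * (ξ ^ m * χ))]

lemma J_zero {N m : ℕ} {r s a b c d : ℝ} (hm0 : m ≠ 0) (hrs : r < s) (hab : a < b) (hcd : c < d)
    {p : EuclideanSpace ℝ (Fin N) × ℝ} (hh : p ∉ cbox N s ×ˢ Icc a d) :
    spc N r s p.1 ^ m * (rampU a b p.2 * rampU' c d p.2) = 0 := by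
  by_cases h1 : p.1 ∈ cbox N s
  · have h2 : p.2 ∉ Icc a d := fun h2 => hh ⟨h1, h2⟩
    by_cases h3 : a ≤ p.2
    · have h4 : d ≤ p.2 := by by_contra h5; exact h2 ⟨h3, (not_le.mp h5).le⟩
      simp only [rampU'_zero hcd (Or.inr h4), mul_zero]
    · simp only [rampU_zero hab (not_le.mp h3).le, mul_zero, zero_mul]
  · simp only [spc_zero hrs h1, zero_pow hm0, zero_mul]

lemma f4_pt {m : ℕ} {θ k T γ κ a b v ξ q t : ℝ} (hm : 2 ≤ m) (hθ : 0 < θ) (hk : 0 < k) (hT : 0 < T)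
    (hTeq : T * γ = θ * k ^ 2) (hγ : 0 < γ) (hκ : 0 < κ) (hκ1 : κ ≤ 1) (hab : a < b)
    (hab' : κ * T / 2 ≤ b - a) (v0 : 0 ≤ v) (vk : v ≤ k) (sp0 : 0 ≤ ξ) (sp1 : ξ ≤ 1)
    (q0 : 0 ≤ q) (q1 : q ≤ 1) :
    v ^ 3 / 3 * (ξ ^ m * (rampU' a b t * (1 - q))) ≤ cS / θ * (κ ^ m)⁻¹ * k * γ := by
  have hcS : 0 < cS := by linarith [cS_one]
  have g1 : rampU' a b t ≤ 2 * cS / (κ * T) := by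
    refine (rampU'_le hab _).trans ?_
    rw [div_le_div_iff₀ (by linarith) (by positivity)]
    nlinarith
  have g0 := rampU'_nonneg hab t
  have g2 : ξ ^ m * (rampU' a b t * (1 - q)) ≤ 2 * cS / (κ * T) := by
    have w1 : ξ ^ m ≤ 1 := pow_le_one₀ sp0 sp1
    have w2 : rampU' a b t * (1 - q) ≤ 2 * cS / (κ * T) := by nlinarith
    have w3 : 0 ≤ rampU' a b t * (1 - q) := mul_nonneg g0 (by linarith)
    nlinarith
  have g3 : κ ^ m ≤ κ := by
    calc κ ^ m ≤ κ ^ 1 := pow_le_pow_of_le_one hκ.le hκ1 (by omega)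
      _ = κ := pow_one κ
  have g4 : κ⁻¹ ≤ (κ ^ m)⁻¹ := inv_anti₀ (by positivity) g3
  calc v ^ 3 / 3 * (ξ ^ m * (rampU' a b t * (1 - q)))
      ≤ k ^ 3 / 3 * (2 * cS / (κ * T)) := by
        gcongr
    _ ≤ k ^ 3 / 2 * (2 * cS / (κ * T)) := by gcongr; norm_num
    _ = cS * κ⁻¹ * k * (k ^ 2 / T) := by field_simp
    _ = cS * κ⁻¹ * k * (γ / θ) := by
        congr 1; rw [div_eq_div_iff hT.ne' hθ.ne']; linarith
    _ ≤ cS * (κ ^ m)⁻¹ * k * (γ / θ) := by gcongr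
    _ = _ := by field_simp

/-- All the data of the problem, after extension by zero. -/
structure Ctx (N m : ℕ) (C0 C1 θ : ℝ) (g G : ℝ → ℝ) (k P T : ℝ)
    (u Vn : EuclideanSpace ℝ (Fin N) × ℝ → ℝ) (Vc ac : Fin N → EuclideanSpace ℝ (Fin N) × ℝ → ℝ)
    (H : EuclideanSpace ℝ (Fin N) × ℝ → ℝ) (M : ℝ) : Prop where
  D : MData volume N (dirx N) (dirt N) (cube N 0 P ×ˢ Ioo (-T) 0) u Vc ac H M
  GD : GData g G m
  hm : 2 ≤ m
  hC0 : 0 < C0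
  hC1 : 0 < C1
  hθ : 0 < θ
  hk : 0 < k
  hP : 0 < P
  hT : 0 < T
  hTeq : T * G (k / P) = θ * k ^ 2
  V_nonneg : ∀ p, 0 ≤ Vn p
  V_le : ∀ i p, |Vc i p| ≤ Vn p
  GV_int : Integrable (fun p => G (Vn p)) volume
  ell : ∀ᵐ p, C0 * G (Vn p) ≤ ∑ i, ac i p * Vc i p
  a_le : ∀ᵐ p, ∀ i, |ac i p| ≤ C1 * g (Vn p)
  u_nonneg : ∀ p, 0 ≤ u p
  u_meas : Measurable u
  u_cont : ContinuousOn u (cube N 0 P ×ˢ Ioo (-T) 0)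

variable {N m : ℕ} {C0 C1 θ : ℝ} {g G : ℝ → ℝ} {k P T : ℝ}
    {u Vn : EuclideanSpace ℝ (Fin N) × ℝ → ℝ} {Vc ac : Fin N → EuclideanSpace ℝ (Fin N) × ℝ → ℝ}
    {H : EuclideanSpace ℝ (Fin N) × ℝ → ℝ} {M : ℝ}

/-- cutoff parameters -/
structure Par (P T k κ kp r s a b c d : ℝ) : Prop where
  hκ : 0 < κ
  hκ1 : κ ≤ 1
  hkp : kp ≤ k
  hrs : κ * P / 2 ≤ s - r
  hsP : s < P
  hab : κ * T / 2 ≤ b - a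
  haT : -T < a
  hcd : c < d
  hd : d < 0

variable {κ kp r s a b c d : ℝ}

set_option maxHeartbeats 1000000 in
lemma Ctx.energy (C : Ctx N m C0 C1 θ g G k P T u Vn Vc ac H M) (Z : Par P T k κ kp r s a b c d)
    {A : Set (EuclideanSpace ℝ (Fin N) × ℝ)} (hA : MeasurableSet A) (hAf : volume A ≠ ⊤)
    (hAs : ∀ p ∈ cbox N s ×ˢ Icc a d, u p < kp → p ∈ A) :
    Integrable (fun p => G (Vn p) * (trc kp (u p) * ctf N m r s a b c d p)) volume ∧
    Integrable (fun p : EuclideanSpace ℝ (Fin N) × ℝ =>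
      trc kp (u p) ^ 3 * (spc N r s p.1 ^ m * (rampU a b p.2 * rampU' c d p.2))) volume ∧
    C0 * (∫ p, G (Vn p) * (trc kp (u p) * ctf N m r s a b c d p)) +
      (1/3) * (∫ p, trc kp (u p) ^ 3 * (spc N r s p.1 ^ m * (rampU a b p.2 * rampU' c d p.2))) ≤
    c2 N m C0 C1 θ * (κ ^ m)⁻¹ * k * G (k / P) * volume.real A := by
  obtain ⟨D, GD, hm, hC0, hC1, hθ, hk, hP, hT, hTeq, V_nonneg, V_le, GV_int, ell, a_le, u_nonneg,
    u_meas, u_cont⟩ := C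
  obtain ⟨hκ, hκ1, hkp, hrs', hsP, hab', haT, hcd, hd⟩ := Z
  have hrs : r < s := by have : 0 < κ * P / 2 := by positivity
                         linarith
  have hab : a < b := by have : 0 < κ * T / 2 := by positivity
                         linarith
  have hm0 : m ≠ 0 := by omega
  have hcS : 0 < cS := by linarith [cS_one]
  set ζ := ctf N m r s a b c d with hζ
  have hsup : tsupport ζ ⊆ cube N 0 P ×ˢ Ioo (-T) 0 := by
    refine (ctf_tsupport hm0 hrs hab hcd).trans ?_
    rintro p ⟨h1, h2⟩
    refine ⟨fun i => ?_, by linarith [h2.1], by linarith [h2.2]⟩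
    have := h1 i
    simpa using lt_of_le_of_lt this hsP
  have hcs : HasCompactSupport ζ := ctf_compact hm0 hrs hab hcd
  have hcd1 : ContDiff ℝ 1 ζ := ctf_contDiff
  have key := D.ident (trc_F kp) (trc_f kp) (continuous_const.mul (trc_cont kp)) hcd1 hcs hsup
  -- measurability and bounds
  have hvm : Measurable fun p => trc kp (u p) := (trc_cont kp).measurable.comp u_meas
  have hv0 : ∀ p, 0 ≤ trc kp (u p) := fun p => trc_nonneg _ _
  have hvk : ∀ p, trc kp (u p) ≤ k := fun p => trc_le (u_nonneg p) hkp hk.le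
  have hζm : Measurable ζ := hcd1.continuous.measurable
  have hζ0 : ∀ p, 0 ≤ ζ p := fun p => ctf_nonneg p
  have hζ1 : ∀ p, ζ p ≤ 1 := fun p => ctf_le_one p
  have hbd : ∀ (f w : EuclideanSpace ℝ (Fin N) × ℝ → ℝ) (c : ℝ), Integrable f → Measurable w →
      (∀ p, |w p| ≤ c) → Integrable (fun p => f p * w p) := fun f w c hf hw hc =>
    Integrable.mul_bdd (c := c) hf hw.aestronglyMeasurable (Eventually.of_forall hc)
  have hvζ : ∀ p, |trc kp (u p) * ζ p| ≤ k := fun p => by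
    rw [abs_of_nonneg (mul_nonneg (hv0 p) (hζ0 p))]
    nlinarith [hv0 p, hvk p, hζ0 p, hζ1 p]
  have I0 : Integrable (fun p => G (Vn p) * (trc kp (u p) * ζ p)) volume :=
    hbd _ _ k GV_int (hvm.mul hζm) hvζ
  have hdm : ∀ v, Continuous fun p => fderiv ℝ ζ p v := fun v =>
    (hcd1.continuous_fderiv one_ne_zero).clm_apply continuous_const
  have hdb : ∀ v, ∃ c, 0 ≤ c ∧ ∀ p, |fderiv ℝ ζ p v| ≤ c := fun v =>
    cs_bdd _ (hdm v) (hcs.fderiv_apply ℝ v)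
  have hdi : ∀ v, Integrable (fun p => fderiv ℝ ζ p v) volume := fun v =>
    (hdm v).integrable_of_hasCompactSupport (hcs.fderiv_apply ℝ v)
  have haV : ∀ i, Integrable (fun p => ac i p * Vc i p) volume := by
    intro i
    refine Integrable.mono' (D.H_int.add D.H_int)
      ((D.a_int i).aestronglyMeasurable.mul (D.V_int i).aestronglyMeasurable) ?_
    filter_upwards [D.dom i] with p hp
    rw [Real.norm_eq_abs, abs_mul]; exact hp p
  have I1 : ∀ i, Integrable (fun p => ac i p * Vc i p * (2 * trc kp (u p) * ζ p)) volume := by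
    intro i
    refine hbd _ _ (2 * k) (haV i) ((hvm.const_mul 2).mul hζm) fun p => ?_
    rw [mul_assoc, abs_mul, abs_two]
    linarith [hvζ p]
  have hv2 : ∀ p, |-(trc kp (u p) ^ 2)| ≤ k ^ 2 := fun p => by
    rw [abs_neg, abs_of_nonneg (pow_nonneg (hv0 p) 2)]
    exact pow_le_pow_left₀ (hv0 p) (hvk p) 2
  have hv3 : ∀ p, trc kp (u p) ^ 3 ≤ k ^ 3 := fun p => pow_le_pow_left₀ (hv0 p) (hvk p) 3
  have I2 : ∀ i, Integrable (fun p => ac i p * (-(trc kp (u p) ^ 2) * fderiv ℝ ζ p (dirx N i))) := by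
    intro i
    obtain ⟨c, hc0, hc⟩ := hdb (dirx N i)
    refine hbd _ _ (k ^ 2 * c) (D.a_int i) (((hvm.pow_const 2).neg).mul (hdm _).measurable) fun p => ?_
    rw [abs_mul]
    exact mul_le_mul (hv2 p) (hc p) (abs_nonneg _) (by positivity)
  have I3 : Integrable (fun p => trc kp (u p) ^ 3 / 3 * fderiv ℝ ζ p (dirt N)) volume := by
    have := hbd _ (fun p => trc kp (u p) ^ 3 / 3) (k ^ 3 / 3) (hdi (dirt N))
      ((hvm.pow_const 3).div_const 3) (fun p => by
        rw [abs_of_nonneg (by have := hv0 p; positivity)]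
        linarith [hv3 p])
    exact this.congr (Eventually.of_forall fun p => mul_comm _ _)
  have hJ : Continuous (fun p : EuclideanSpace ℝ (Fin N) × ℝ =>
      spc N r s p.1 ^ m * (rampU a b p.2 * rampU' c d p.2)) :=
    (((spc_contDiff r s).continuous.comp continuous_fst).pow m).mul
      (((rampU_contDiff a b).continuous.comp continuous_snd).mul
        ((rampU'_cont c d).comp continuous_snd))
  have hJc : HasCompactSupport (fun p : EuclideanSpace ℝ (Fin N) × ℝ =>
      spc N r s p.1 ^ m * (rampU a b p.2 * rampU' c d p.2)) := by
    refine HasCompactSupport.of_support_subset_isCompact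
      ((cbox_compact s).prod (isCompact_Icc (a := a) (b := d))) ?_
    intro p hp
    by_contra hh
    exact hp (J_zero hm0 hrs hab hcd hh)
  have I4 : Integrable (fun p : EuclideanSpace ℝ (Fin N) × ℝ =>
      trc kp (u p) ^ 3 * (spc N r s p.1 ^ m * (rampU a b p.2 * rampU' c d p.2))) volume := by
    have := hbd _ (fun p => trc kp (u p) ^ 3) (k ^ 3) (hJ.integrable_of_hasCompactSupport hJc)
      (hvm.pow_const 3) (fun p => by
        rw [abs_of_nonneg (pow_nonneg (hv0 p) 3)]; exact hv3 p)
    exact this.congr (Eventually.of_forall fun p => mul_comm _ _)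
  refine ⟨I0, I4, ?_⟩
  set B := c2 N m C0 C1 θ * (κ ^ m)⁻¹ * k * G (k / P) with hB
  have hind : Integrable (A.indicator fun _ => B) volume :=
    (integrable_indicator_iff hA).mpr (integrableOn_const hAf)
  have hindI : ∫ p, A.indicator (fun _ => B) p = B * volume.real A := by
    rw [integral_indicator hA, setIntegral_const, smul_eq_mul, mul_comm]
  have e1 : ∑ i, ∫ p, ac i p * Vc i p * (2 * trc kp (u p) * ζ p) =
      ∫ p, ∑ i, ac i p * Vc i p * (2 * trc kp (u p) * ζ p) :=
    (integral_finsetSum _ fun i _ => I1 i).symm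
  have e2 : ∑ i, ∫ p, ac i p * (-(trc kp (u p) ^ 2) * fderiv ℝ ζ p (dirx N i)) =
      ∫ p, ∑ i, ac i p * (-(trc kp (u p) ^ 2) * fderiv ℝ ζ p (dirx N i)) :=
    (integral_finsetSum _ fun i _ => I2 i).symm
  have IS1 := integrable_finsetSum Finset.univ fun i _ => I1 i
  have IS2 := integrable_finsetSum Finset.univ fun i _ => I2 i
  rw [e1, e2] at key
  have hpt : ∀ᵐ p, C0 * (G (Vn p) * (trc kp (u p) * ζ p)) +
      (1/3) * (trc kp (u p) ^ 3 * (spc N r s p.1 ^ m * (rampU a b p.2 * rampU' c d p.2))) +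
      (trc kp (u p) ^ 3 / 3 * fderiv ℝ ζ p (dirt N) -
        ∑ i, ac i p * (-(trc kp (u p) ^ 2) * fderiv ℝ ζ p (dirx N i))) ≤
      ∑ i, ac i p * Vc i p * (2 * trc kp (u p) * ζ p) + A.indicator (fun _ => B) p := by
    filter_upwards [ell, a_le] with p hell hale
    have hγ : 0 < G (k / P) := GD.G_pos (by positivity)
    have h5p : 0 ≤ c5 N m C0 C1 := by
      have : 1 ≤ c4 N m C0 C1 := le_max_left _ _
      unfold c5; positivity
    have hB0 : 0 ≤ B := by rw [hB]; unfold c2; positivity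
    have hI0 : 0 ≤ A.indicator (fun _ => B) p := indicator_nonneg (fun _ _ => hB0) p
    have f1 : ∑ i, ac i p * Vc i p * (2 * trc kp (u p) * ζ p) ≥
        2 * (C0 * (G (Vn p) * (trc kp (u p) * ζ p))) := by
      rw [← Finset.sum_mul]
      have := mul_le_mul_of_nonneg_right hell (mul_nonneg (hv0 p) (hζ0 p))
      nlinarith
    rw [hζ, ctf_fderiv_t, ← hζ]
    by_cases hz : trc kp (u p) = 0
    · simp only [hz, ne_eq, OfNat.ofNat_ne_zero, not_false_eq_true, zero_pow, zero_mul, mul_zero,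
        neg_zero, Finset.sum_const_zero, zero_div, sub_zero, add_zero, zero_add]
      exact hI0
    have huk : u p < kp := by
      by_contra h; exact hz (trc_zero (not_lt.mp h))
    by_cases hb : p ∈ cbox N s ×ˢ Icc a d
    swap
    · have z1 : ζ p = 0 := ctf_zero hm0 hrs hab hcd hb
      have z2 : ∀ v, fderiv ℝ ζ p v = 0 := by
        intro v
        have : p ∉ tsupport ζ := fun h => hb (ctf_tsupport hm0 hrs hab hcd h)
        rw [fderiv_of_notMem_tsupport _ this]; rfl
      have z3 := z2 (dirt N)
      rw [hζ, ctf_fderiv_t] at z3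
      have z4 : spc N r s p.1 ^ m * (rampU a b p.2 * rampU' c d p.2) = 0 :=
        J_zero hm0 hrs hab hcd hb
      simp only [z1, z2, z3, z4, mul_zero, Finset.sum_const_zero, sub_zero, add_zero, zero_add]
      exact hI0
    rw [indicator_of_mem (hAs p hb huk)]
    set v := trc kp (u p) with hv
    have v0 : 0 ≤ v := hv0 p
    have vk : v ≤ k := hvk p
    have sp0 := spc_nonneg (N := N) r s p.1
    have sp1 := spc_le_one (N := N) r s p.1
    have t0 := tmc_nonneg a b c d p.2
    have t1 := tmc_le_one a b c d p.2
    -- gradient part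
    have f2 : -∑ i, ac i p * (-(v ^ 2) * fderiv ℝ ζ p (dirx N i)) ≤
        (C1 * g (Vn p)) * v ^ 2 *
          (N * (m * (4 * cS / (κ * P)) * (spc N r s p.1 ^ (m - 1) * tmc a b c d p.2))) := by
      rw [← Finset.sum_neg_distrib]
      have hgn : 0 ≤ g (Vn p) := GD.nonneg _ (V_nonneg p)
      have : ∀ i ∈ Finset.univ, -(ac i p * (-(v ^ 2) * fderiv ℝ ζ p (dirx N i))) ≤
          (C1 * g (Vn p)) * v ^ 2 *
          (m * (4 * cS / (κ * P)) * (spc N r s p.1 ^ (m - 1) * tmc a b c d p.2)) := by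
        intro i _
        have h1 := ctf_fderiv_x (m := m) (a := a) (b := b) (c := c) (d := d) hrs p i
        rw [← hζ] at h1
        have h2 : 2 * cS / (s - r) ≤ 4 * cS / (κ * P) := by
          rw [div_le_div_iff₀ (by linarith) (by positivity)]
          nlinarith
        have h3 : |fderiv ℝ ζ p (dirx N i)| ≤
            m * (4 * cS / (κ * P)) * (spc N r s p.1 ^ (m - 1) * tmc a b c d p.2) := by
          refine h1.trans ?_
          gcongr
        calc -(ac i p * (-(v ^ 2) * fderiv ℝ ζ p (dirx N i)))
            ≤ |-(ac i p * (-(v ^ 2) * fderiv ℝ ζ p (dirx N i)))| := le_abs_self _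
          _ = |ac i p| * v ^ 2 * |fderiv ℝ ζ p (dirx N i)| := by
              rw [abs_neg, abs_mul, abs_mul, abs_neg, abs_of_nonneg (pow_nonneg v0 2)]; ring
          _ ≤ _ := mul_le_mul (mul_le_mul_of_nonneg_right (hale i) (by positivity)) h3
              (abs_nonneg _) (by positivity)
      refine (Finset.sum_le_sum this).trans (le_of_eq ?_)
      rw [Finset.sum_const, Finset.card_univ, Fintype.card_fin, nsmul_eq_mul]; ring
    have f3 := young_pt GD N (k := k) hm hC0 hC1 hk hP hκ hκ1 (V_nonneg p) v0 vk sp0 sp1 t0 t1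
    have f4 : v ^ 3 / 3 * (spc N r s p.1 ^ m * (rampU' a b p.2 * (1 - rampU c d p.2))) ≤
        cS / θ * (κ ^ m)⁻¹ * k * G (k / P) :=
      f4_pt hm hθ hk hT hTeq hγ hκ hκ1 hab hab' v0 vk sp0 sp1 (rampU_nonneg c d p.2)
        (rampU_le_one c d p.2)
    have hBs : B = c5 N m C0 C1 * (κ ^ m)⁻¹ * k * G (k / P) + cS / θ * (κ ^ m)⁻¹ * k * G (k / P) := by
      rw [hB]; unfold c2; ring
    have f5 : ζ p = spc N r s p.1 ^ m * tmc a b c d p.2 := rfl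
    have f6 : v ^ 3 / 3 * (spc N r s p.1 ^ m * tmc' a b c d p.2) =
        v ^ 3 / 3 * (spc N r s p.1 ^ m * (rampU' a b p.2 * (1 - rampU c d p.2))) -
        (1/3) * (v ^ 3 * (spc N r s p.1 ^ m * (rampU a b p.2 * rampU' c d p.2))) := by
      unfold tmc'; ring
    rw [← f5] at f3
    rw [f6]
    linarith
  have J0 := I0.const_mul C0
  have J4 := I4.const_mul (1/3)
  have hint := integral_mono_ae ((J0.add J4).add (I3.sub IS2)) (IS1.add hind) hpt
  rw [integral_add' (J0.add J4) (I3.sub IS2), integral_add' J0 J4, integral_sub' I3 IS2,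
    integral_add' IS1 hind, integral_const_mul, integral_const_mul, hindI, key] at hint
  linarith

end Energy

section Slices
open Filter Topology

lemma rampU'_integrable {a b : ℝ} (hab : a < b) : Integrable (rampU' a b) volume := by
  refine (rampU'_cont a b).integrable_of_hasCompactSupport ?_
  refine HasCompactSupport.of_support_subset_isCompact (isCompact_Icc (a := a) (b := b)) ?_
  intro t ht
  by_contra h
  refine ht (rampU'_zero hab ?_)
  by_contra hh
  push Not at hh
  exact h ⟨hh.1.le, hh.2.le⟩

lemma rampU'_integral {a b : ℝ} (hab : a < b) : ∫ t, rampU' a b t = 1 := by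
  have h := integral_of_hasDerivAt_of_tendsto (rampU_hasDerivAt a b) (rampU'_integrable hab)
    (m := 0) (n := 1) ?_ ?_
  · simpa using h
  · refine tendsto_const_nhds.congr' ?_
    filter_upwards [eventually_le_atBot a] with t ht
    rw [rampU_zero hab ht]
  · refine tendsto_const_nhds.congr' ?_
    filter_upwards [eventually_ge_atTop b] with t ht
    rw [rampU_one hab ht]

variable {N m : ℕ} {C0 C1 θ : ℝ} {g G : ℝ → ℝ} {k P T : ℝ}
    {u Vn : EuclideanSpace ℝ (Fin N) × ℝ → ℝ} {Vc ac : Fin N → EuclideanSpace ℝ (Fin N) × ℝ → ℝ}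
    {H : EuclideanSpace ℝ (Fin N) × ℝ → ℝ} {M : ℝ}
variable {κ kp r s a b c d : ℝ}

/-- parameters without the final time ramp -/
structure Par0 (P T k κ kp r s a b : ℝ) : Prop where
  hκ : 0 < κ
  hκ1 : κ ≤ 1
  hkp : kp ≤ k
  hrs : κ * P / 2 ≤ s - r
  hsP : s < P
  hab : κ * T / 2 ≤ b - a
  haT : -T < a

lemma Par0.par (Z : Par0 P T k κ kp r s a b) (hcd : c < d) (hd : d < 0) :
    Par P T k κ kp r s a b c d := ⟨Z.hκ, Z.hκ1, Z.hkp, Z.hrs, Z.hsP, Z.hab, Z.haT, hcd, hd⟩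

/-- the energy bound -/
def eB (N m : ℕ) (C0 C1 θ k P κ : ℝ) (G : ℝ → ℝ) (S : ℝ) : ℝ :=
  c2 N m C0 C1 θ * (κ ^ m)⁻¹ * k * G (k / P) * S

lemma spc_pow_integrable (hm : m ≠ 0) (hrs : r < s) :
    Integrable (fun x : EuclideanSpace ℝ (Fin N) => spc N r s x ^ m) volume := by
  refine ((spc_contDiff r s).continuous.pow m).integrable_of_hasCompactSupport ?_
  refine HasCompactSupport.of_support_subset_isCompact (cbox_compact s) ?_
  intro x hx
  by_contra h
  exact hx (by show spc N r s x ^ m = 0; rw [spc_zero hrs h, zero_pow hm])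

lemma Ctx.slice_int (C : Ctx N m C0 C1 θ g G k P T u Vn Vc ac H M) (hrs : r < s) (hkp : kp ≤ k)
    (t : ℝ) : Integrable (fun x => trc kp (u (x, t)) ^ 3 * spc N r s x ^ m) volume := by
  have hm0 : m ≠ 0 := by have := C.hm; omega
  refine (Integrable.mul_bdd (c := k ^ 3) (spc_pow_integrable (N := N) hm0 hrs)
    (g := fun x => trc kp (u (x, t)) ^ 3) ?_ ?_).congr
    (Eventually.of_forall fun x => mul_comm _ _)
  · exact ((((trc_cont kp).measurable.comp C.u_meas).comp
      (measurable_id.prodMk measurable_const)).pow_const 3).aestronglyMeasurable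
  · refine Eventually.of_forall fun x => ?_
    rw [Real.norm_eq_abs, abs_of_nonneg (pow_nonneg (trc_nonneg _ _) 3)]
    exact pow_le_pow_left₀ (trc_nonneg _ _) (trc_le (C.u_nonneg _) hkp C.hk.le) 3

lemma Ctx.slice_cont (C : Ctx N m C0 C1 θ g G k P T u Vn Vc ac H M) (hrs : r < s) (hkp : kp ≤ k)
    (hsP : s < P) {τ : ℝ} (hτ : τ ∈ Ioo (-T) 0) :
    ContinuousAt (fun t => ∫ x, trc kp (u (x, t)) ^ 3 * spc N r s x ^ m) τ := by
  have hm0 : m ≠ 0 := by have := C.hm; omega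
  refine continuousAt_of_dominated (bound := fun x => k ^ 3 * spc N r s x ^ m) ?_ ?_ ?_ ?_
  · exact Eventually.of_forall fun t => (C.slice_int hrs hkp t).aestronglyMeasurable
  · refine Eventually.of_forall fun t => Eventually.of_forall fun x => ?_
    have h1 := trc_nonneg kp (u (x, t))
    have h2 := spc_nonneg (N := N) r s x
    rw [Real.norm_eq_abs, abs_of_nonneg (by positivity)]
    exact mul_le_mul_of_nonneg_right (pow_le_pow_left₀ h1 (trc_le (C.u_nonneg _) hkp C.hk.le) 3)
      (by positivity)
  · exact (spc_pow_integrable hm0 hrs).const_mul _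
  · refine Eventually.of_forall fun x => ?_
    by_cases hx : x ∈ cbox N s
    · have hxQ : (x, τ) ∈ cube N 0 P ×ˢ Ioo (-T) 0 := by
        refine ⟨fun i => ?_, hτ⟩
        simpa using lt_of_le_of_lt (hx i) hsP
      have h1 : ContinuousAt u (x, τ) := C.u_cont.continuousAt (C.D.Qopen.mem_nhds hxQ)
      have h2 : ContinuousAt (fun t : ℝ => u (x, t)) τ :=
        ContinuousAt.comp (f := fun t : ℝ => (x, t)) h1 (by fun_prop)
      exact ((((trc_cont kp).continuousAt.comp h2).pow 3)).mul continuousAt_const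
    · simp only [spc_zero hrs hx, zero_pow hm0, mul_zero]
      exact continuousAt_const

lemma Ctx.slice (C : Ctx N m C0 C1 θ g G k P T u Vn Vc ac H M) (Z : Par0 P T k κ kp r s a b)
    {A : Set (EuclideanSpace ℝ (Fin N) × ℝ)} (hA : MeasurableSet A) (hAf : volume A ≠ ⊤)
    (hAs : ∀ p ∈ cbox N s ×ˢ Ico a 0, u p < kp → p ∈ A) {τ : ℝ} (hbτ : b ≤ τ) (hτ : τ < 0) :
    ∫ x, trc kp (u (x, τ)) ^ 3 * spc N r s x ^ m ≤ 3 * eB N m C0 C1 θ k P κ G (volume.real A) := by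
  have hP := C.hP
  have hT := C.hT
  have hκ := Z.hκ
  have hrs : r < s := by have : 0 < κ * P / 2 := by positivity
                         linarith [Z.hrs]
  have hab : a < b := by have : 0 < κ * T / 2 := by positivity
                         linarith [Z.hab]
  by_contra hcon
  push Not at hcon
  set B := eB N m C0 C1 θ k P κ G (volume.real A) with hB
  set J := fun t => ∫ x, trc kp (u (x, t)) ^ 3 * spc N r s x ^ m with hJ
  obtain ⟨c0, hc1, hc2⟩ := exists_between hcon
  have hJc : ContinuousAt J τ := C.slice_cont hrs Z.hkp Z.hsP ⟨by linarith [Z.haT], hτ⟩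
  obtain ⟨δ, hδ, hδJ⟩ := Metric.eventually_nhds_iff.mp (hJc.eventually (lt_mem_nhds hc2))
  obtain ⟨d, hd1, hd2⟩ := exists_between (lt_min (by linarith : τ < τ + δ) hτ)
  have hd3 : d < τ + δ := hd2.trans_le (min_le_left _ _)
  have hd0 : d < 0 := hd2.trans_le (min_le_right _ _)
  obtain ⟨I0, I4, hE⟩ := C.energy (Z.par hd1 hd0) hA hAf
    (fun p hp => hAs p ⟨hp.1, hp.2.1, lt_of_le_of_lt hp.2.2 hd0⟩)
  have h0 : 0 ≤ ∫ p, G (Vn p) * (trc kp (u p) * ctf N m r s a b τ d p) :=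
    integral_nonneg fun p => mul_nonneg (C.GD.G_nonneg (C.V_nonneg p))
      (mul_nonneg (trc_nonneg _ _) (ctf_nonneg p))
  have I4' := I4
  rw [Measure.volume_eq_prod] at I4'
  have hF : ∫ p : EuclideanSpace ℝ (Fin N) × ℝ,
      trc kp (u p) ^ 3 * (spc N r s p.1 ^ m * (rampU a b p.2 * rampU' τ d p.2)) =
      ∫ t, J t * (rampU a b t * rampU' τ d t) := by
    rw [Measure.volume_eq_prod, integral_prod_symm _ I4']
    congr 1; ext t
    rw [hJ, ← integral_mul_const]
    congr 1; ext x; ring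
  have hFi : Integrable (fun t => J t * (rampU a b t * rampU' τ d t)) volume := by
    refine I4'.integral_prod_right.congr (Eventually.of_forall fun t => ?_)
    simp only [hJ]
    rw [← integral_mul_const]
    congr 1; ext x; ring
  have hlow : c0 ≤ ∫ t, J t * (rampU a b t * rampU' τ d t) := by
    have e : c0 = ∫ t, c0 * rampU' τ d t := by rw [integral_const_mul, rampU'_integral hd1, mul_one]
    rw [e]
    refine integral_mono ((rampU'_integrable hd1).const_mul c0) hFi fun t => ?_
    by_cases ht : t ≤ τ ∨ d ≤ t
    · simp only [rampU'_zero hd1 ht, mul_zero, le_refl]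
    · push Not at ht
      have h1 : rampU a b t = 1 := rampU_one hab (by linarith)
      have h2 : c0 < J t := hδJ (by rw [Real.dist_eq, abs_lt]; constructor <;> linarith)
      simp only [h1, one_mul]
      exact mul_le_mul_of_nonneg_right h2.le (rampU'_nonneg hd1 t)
  rw [hF] at hE
  have hC0 := C.hC0
  have : 0 ≤ C0 * ∫ p, G (Vn p) * (trc kp (u p) * ctf N m r s a b τ d p) := mul_nonneg hC0.le h0
  have hE' : (1/3) * (∫ t, J t * (rampU a b t * rampU' τ d t)) ≤ B := by
    rw [hB, eB]; linarith
  linarith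

/-- constant -/
def c3 (N m : ℕ) (C0 C1 θ : ℝ) : ℝ := 3 + 3 * c2 N m C0 C1 θ / C0 + 4 * m * cS

lemma Ctx.grad (C : Ctx N m C0 C1 θ g G k P T u Vn Vc ac H M) (Z : Par P T k κ kp r s a b c d)
    {A : Set (EuclideanSpace ℝ (Fin N) × ℝ)} (hA : MeasurableSet A) (hAf : volume A ≠ ⊤)
    (hAs : ∀ p ∈ cbox N s ×ˢ Icc a d, u p < kp → p ∈ A) (i : Fin N) :
    (∫ p, |Vc i p * (-(3 * trc kp (u p) ^ 2) * ctf N m r s a b c d p)|) +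
      ∫ p, |trc kp (u p) ^ 3 * fderiv ℝ (ctf N m r s a b c d) p (dirx N i)| ≤
    c3 N m C0 C1 θ * (κ ^ m)⁻¹ * (k ^ 3 / P) * volume.real A := by
  have hP := C.hP
  have hT := C.hT
  have hk := C.hk
  have hκ := Z.hκ
  have hκ1 := Z.hκ1
  have hC0 := C.hC0
  have hC1 := C.hC1
  have hθ := C.hθ
  have hrs : r < s := by have : 0 < κ * P / 2 := by positivity
                         linarith [Z.hrs]
  have hab : a < b := by have : 0 < κ * T / 2 := by positivity
                         linarith [Z.hab]
  have hcS : 0 < cS := by linarith [cS_one]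
  have hm := C.hm
  have hm0 : m ≠ 0 := by omega
  have hγ : 0 < G (k / P) := C.GD.G_pos (by positivity)
  obtain ⟨I0, I4, hE⟩ := C.energy Z hA hAf hAs
  have h0 : 0 ≤ ∫ p : EuclideanSpace ℝ (Fin N) × ℝ,
      trc kp (u p) ^ 3 * (spc N r s p.1 ^ m * (rampU a b p.2 * rampU' c d p.2)) :=
    integral_nonneg fun p => mul_nonneg (pow_nonneg (trc_nonneg _ _) 3)
      (mul_nonneg (pow_nonneg (spc_nonneg _ _ _) m) (mul_nonneg (rampU_nonneg _ _ _)
        (rampU'_nonneg Z.hcd _)))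
  set S := volume.real A with hS
  set Y := ∫ p, G (Vn p) * (trc kp (u p) * ctf N m r s a b c d p) with hY
  have hYB : C0 * Y ≤ c2 N m C0 C1 θ * (κ ^ m)⁻¹ * k * G (k / P) * S := by linarith
  have hS0 : 0 ≤ S := measureReal_nonneg
  have hin : ∀ p, trc kp (u p) ≠ 0 → p ∈ cbox N s ×ˢ Icc a d → p ∈ A := fun p h1 h2 =>
    hAs p h2 (by by_contra h; exact h1 (trc_zero (not_lt.mp h)))
  have hI1 : Integrable (A.indicator fun _ => (1:ℝ)) volume :=
    (integrable_indicator_iff hA).mpr (integrableOn_const hAf)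
  have hI1i : ∫ p, A.indicator (fun _ => (1:ℝ)) p = S := by
    rw [integral_indicator hA, setIntegral_const, smul_eq_mul, mul_one]
  have hκm : 1 ≤ (κ ^ m)⁻¹ := (one_le_inv₀ (by positivity)).mpr (pow_le_one₀ hκ.le hκ1)
  have g4 : κ⁻¹ ≤ (κ ^ m)⁻¹ := inv_anti₀ (by positivity) (by
    calc κ ^ m ≤ κ ^ 1 := pow_le_pow_of_le_one hκ.le hκ1 (by omega)
      _ = κ := pow_one κ)
  have b1 : ∫ p, |Vc i p * (-(3 * trc kp (u p) ^ 2) * ctf N m r s a b c d p)| ≤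
      3 * k * (k / P) * (k * S + Y / G (k / P)) := by
    have hgi : Integrable (fun p => 3 * k * (k / P) * (k * A.indicator (fun _ => (1:ℝ)) p +
        (G (Vn p) * (trc kp (u p) * ctf N m r s a b c d p)) / G (k / P))) volume :=
      ((hI1.const_mul k).add (I0.div_const _)).const_mul _
    have e : ∫ p, 3 * k * (k / P) * (k * A.indicator (fun _ => (1:ℝ)) p +
        (G (Vn p) * (trc kp (u p) * ctf N m r s a b c d p)) / G (k / P)) =
        3 * k * (k / P) * (k * S + Y / G (k / P)) := by
      rw [integral_const_mul, integral_add (hI1.const_mul k) (I0.div_const _), integral_const_mul,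
        hI1i, integral_div]
    rw [← e]
    refine integral_mono_of_nonneg (Eventually.of_forall fun p => abs_nonneg _) hgi
      (Eventually.of_forall fun p => ?_)
    simp only
    have v0 := trc_nonneg kp (u p)
    have vk : trc kp (u p) ≤ k := trc_le (C.u_nonneg p) Z.hkp hk.le
    have z0 := ctf_nonneg (N := N) (m := m) (r := r) (s := s) (a := a) (b := b) (c := c) (d := d) p
    have z1 := ctf_le_one (N := N) (m := m) (r := r) (s := s) (a := a) (b := b) (c := c) (d := d) p
    have hlin := C.GD.lin (r := k / P) (by positivity) (C.V_nonneg p)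
    have hGn := C.GD.G_nonneg (C.V_nonneg p)
    have hle := C.V_le i p
    have hvz : trc kp (u p) * ctf N m r s a b c d p ≤ k * A.indicator (fun _ => (1:ℝ)) p := by
      by_cases hz : trc kp (u p) = 0
      · rw [hz, zero_mul]
        exact mul_nonneg hk.le (indicator_nonneg (fun _ _ => zero_le_one) p)
      by_cases hb : p ∈ cbox N s ×ˢ Icc a d
      · rw [indicator_of_mem (hin p hz hb), mul_one]; nlinarith
      · rw [ctf_zero hm0 hrs hab Z.hcd hb, mul_zero]
        exact mul_nonneg hk.le (indicator_nonneg (fun _ _ => zero_le_one) p)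
    set v := trc kp (u p)
    set z := ctf N m r s a b c d p
    calc |Vc i p * (-(3 * v ^ 2) * z)| = |Vc i p| * (3 * v ^ 2 * z) := by
          rw [abs_mul, abs_mul, abs_neg, abs_of_nonneg (by positivity : 0 ≤ 3 * v ^ 2),
            abs_of_nonneg z0]
      _ ≤ (k / P * (1 + G (Vn p) / G (k / P))) * (3 * (k * v) * z) := by
          refine mul_le_mul (hle.trans hlin) ?_ (by positivity) (by positivity)
          refine mul_le_mul_of_nonneg_right ?_ z0
          nlinarith
      _ = 3 * k * (k / P) * (v * z + G (Vn p) * (v * z) / G (k / P)) := by ring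
      _ ≤ _ := by gcongr
  have b2 : ∫ p, |trc kp (u p) ^ 3 * fderiv ℝ (ctf N m r s a b c d) p (dirx N i)| ≤
      k ^ 3 * (m * (4 * cS / (κ * P))) * S := by
    rw [← hI1i, ← integral_const_mul]
    refine integral_mono_of_nonneg (Eventually.of_forall fun p => abs_nonneg _)
      (hI1.const_mul _) (Eventually.of_forall fun p => ?_)
    simp only
    have v0 := trc_nonneg kp (u p)
    have vk : trc kp (u p) ≤ k := trc_le (C.u_nonneg p) Z.hkp hk.le
    have hnn : 0 ≤ k ^ 3 * (m * (4 * cS / (κ * P))) * A.indicator (fun _ => (1:ℝ)) p :=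
      mul_nonneg (by positivity) (indicator_nonneg (fun _ _ => zero_le_one) p)
    by_cases hz : trc kp (u p) = 0
    · rw [hz]; simpa using hnn
    by_cases hb : p ∈ cbox N s ×ˢ Icc a d
    swap
    · have : p ∉ tsupport (ctf N m r s a b c d) := fun h => hb (ctf_tsupport hm0 hrs hab Z.hcd h)
      rw [fderiv_of_notMem_tsupport _ this]; simpa using hnn
    rw [indicator_of_mem (hin p hz hb), mul_one, abs_mul, abs_of_nonneg (pow_nonneg v0 3)]
    have h1 := ctf_fderiv_x (m := m) (a := a) (b := b) (c := c) (d := d) hrs p i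
    have h2 : 2 * cS / (s - r) ≤ 4 * cS / (κ * P) := by
      rw [div_le_div_iff₀ (by linarith) (by positivity)]
      nlinarith [Z.hrs]
    have h3 : spc N r s p.1 ^ (m - 1) * tmc a b c d p.2 ≤ 1 :=
      mul_le_one₀ (pow_le_one₀ (spc_nonneg _ _ _) (spc_le_one _ _ _)) (tmc_nonneg _ _ _ _ _)
        (tmc_le_one _ _ _ _ _)
    have h4 : 0 ≤ 2 * cS / (s - r) := div_nonneg (by positivity) (by linarith)
    refine mul_le_mul (pow_le_pow_left₀ v0 vk 3) (h1.trans ?_) (abs_nonneg _) (by positivity)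
    calc _ ≤ m * (2 * cS / (s - r)) * 1 := mul_le_mul_of_nonneg_left h3 (by positivity)
      _ ≤ _ := by rw [mul_one]; gcongr
  refine (add_le_add b1 b2).trans ?_
  have hY2 : Y / G (k / P) ≤ c2 N m C0 C1 θ / C0 * (κ ^ m)⁻¹ * k * S := by
    rw [div_le_iff₀ hγ]
    have : Y ≤ (c2 N m C0 C1 θ * (κ ^ m)⁻¹ * k * G (k / P) * S) / C0 := by
      rw [le_div_iff₀ hC0]; linarith
    refine this.trans (le_of_eq ?_)
    field_simp
  have e1 : 3 * k * (k / P) * (k * S + Y / G (k / P)) ≤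
      3 * k * (k / P) * (k * ((κ ^ m)⁻¹ * S) + c2 N m C0 C1 θ / C0 * (κ ^ m)⁻¹ * k * S) := by
    have : S ≤ (κ ^ m)⁻¹ * S := by nlinarith
    gcongr
  have e2 : k ^ 3 * (m * (4 * cS / (κ * P))) * S ≤ k ^ 3 / P * (4 * m * cS) * (κ ^ m)⁻¹ * S := by
    calc k ^ 3 * (m * (4 * cS / (κ * P))) * S = k ^ 3 / P * (4 * m * cS) * κ⁻¹ * S := by field_simp
      _ ≤ _ := by gcongr
  refine (add_le_add e1 e2).trans (le_of_eq ?_)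
  unfold c3
  field_simp

end Slices

section Trans
open Filter Topology

variable {N m : ℕ}

lemma ball_avg {w : EuclideanSpace ℝ (Fin N) × ℝ → ℝ} (hw : Measurable w)
    (hwi : Integrable w volume) (w0 : ∀ p, 0 ≤ w p) {B : ℝ} (wB : ∀ p, w p ≤ B)
    {E0 : Set (EuclideanSpace ℝ (Fin N) × ℝ)} (hE : MeasurableSet E0) (hEf : volume E0 ≠ ⊤)
    {R L η β : ℝ}
    (hL : ∀ y : EuclideanSpace ℝ (Fin N), ‖y‖ < R →
      ∫ p : EuclideanSpace ℝ (Fin N) × ℝ, |w (p + (y, 0)) - w p| ≤ L)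
    (hη : ∀ p ∈ E0, η ≤ w p) (hsl : ∀ t, Integrable (fun x => w (x, t)) volume)
    (hβ : ∀ p ∈ E0, ∫ x, w (x, p.2) ≤ β) :
    (η * volume.real (Metric.ball (0 : EuclideanSpace ℝ (Fin N)) R) - β) * volume.real E0 ≤
      volume.real (Metric.ball (0 : EuclideanSpace ℝ (Fin N)) R) * L := by
  have hsh : ∀ (p : EuclideanSpace ℝ (Fin N) × ℝ) (y : EuclideanSpace ℝ (Fin N)),
      p + (y, 0) = (p.1 + y, p.2) := by intro p y; ext <;> simp
  set Bl := Metric.ball (0 : EuclideanSpace ℝ (Fin N)) R with hBl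
  have hBf : volume Bl ≠ ⊤ := Metric.isBounded_ball.measure_lt_top.ne
  have hBm : MeasurableSet Bl := measurableSet_ball
  have : IsFiniteMeasure (volume.restrict E0) := ⟨by simpa using hEf.lt_top⟩
  have : IsFiniteMeasure (volume.restrict Bl) := ⟨by simpa using hBf.lt_top⟩
  set F : (EuclideanSpace ℝ (Fin N) × ℝ) → EuclideanSpace ℝ (Fin N) → ℝ :=
    fun p y => w p - w (p + (y, 0)) with hF
  have hFb : ∀ p y, ‖F p y‖ ≤ B := fun p y => by
    rw [Real.norm_eq_abs, abs_le]
    have h1 := w0 p; have h2 := w0 (p + (y, 0)); have h3 := wB p; have h4 := wB (p + (y, 0))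
    constructor <;> simp only [hF] <;> linarith
  have hFm : Measurable (Function.uncurry F) := by
    refine (hw.comp measurable_fst).sub (hw.comp ?_)
    exact measurable_fst.add (measurable_snd.prodMk measurable_const)
  have hFi : Integrable (Function.uncurry F) ((volume.restrict E0).prod (volume.restrict Bl)) :=
    Integrable.of_bound hFm.aestronglyMeasurable B (Eventually.of_forall fun z => hFb z.1 z.2)
  have hswap := integral_integral_swap hFi
  have h1 : (η * volume.real Bl - β) * volume.real E0 ≤ ∫ p in E0, ∫ y in Bl, F p y := by
    have hc : (η * volume.real Bl - β) * volume.real E0 = ∫ p in E0, (η * volume.real Bl - β) := by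
      rw [setIntegral_const, smul_eq_mul, mul_comm]
    rw [hc]
    refine setIntegral_mono_on (integrable_const _) hFi.integral_prod_left hE ?_
    intro p hp
    have hti : Integrable (fun y => w (p + (y, 0))) volume := by
      have := (hsl p.2).comp_add_left p.1
      refine this.congr (Eventually.of_forall fun y => ?_)
      simp only [hsh]
    have hte : ∫ y, w (p + (y, 0)) = ∫ x, w (x, p.2) := by
      rw [← integral_add_left_eq_self (fun x => w (x, p.2)) p.1]
      congr 1; ext y
      rw [hsh]
    have e1 : ∫ y in Bl, F p y = w p * volume.real Bl - ∫ y in Bl, w (p + (y, 0)) := by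
      simp only [hF]
      rw [integral_sub (integrable_const _) hti.integrableOn, setIntegral_const, smul_eq_mul, mul_comm]
    rw [e1]
    have e2 : ∫ y in Bl, w (p + (y, 0)) ≤ ∫ y, w (p + (y, 0)) :=
      setIntegral_le_integral hti (Eventually.of_forall fun y => w0 _)
    have e3 := hβ p hp
    have e4 := mul_le_mul_of_nonneg_right (hη p hp) (measureReal_nonneg (μ := volume) (s := Bl))
    linarith
  have h2 : ∫ y in Bl, ∫ p in E0, F p y ≤ volume.real Bl * L := by
    have hc : volume.real Bl * L = ∫ y in Bl, L := by rw [setIntegral_const, smul_eq_mul]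
    rw [hc]
    refine setIntegral_mono_on hFi.integral_prod_right (integrable_const _) hBm ?_
    intro y hy
    have hy' : ‖y‖ < R := by simpa [hBl] using hy
    refine le_trans ?_ (hL y hy')
    have hwt : Integrable (fun p => w (p + (y, 0))) volume := hwi.comp_add_right _
    have hi : Integrable (fun p => |w (p + (y, 0)) - w p|) volume := (hwt.sub hwi).abs
    refine le_trans (setIntegral_mono (hwi.sub hwt).integrableOn hi.integrableOn fun p => ?_)
      (setIntegral_le_integral hi (Eventually.of_forall fun p => abs_nonneg _))
    rw [abs_sub_comm]; exact le_abs_self _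
  linarith


variable {C0 C1 θ : ℝ} {g G : ℝ → ℝ} {k P T : ℝ}
    {u Vn : EuclideanSpace ℝ (Fin N) × ℝ → ℝ} {Vc ac : Fin N → EuclideanSpace ℝ (Fin N) × ℝ → ℝ}
    {H : EuclideanSpace ℝ (Fin N) × ℝ → ℝ} {M : ℝ}
variable {κ kp r s a b : ℝ}

lemma Ctx.step_pre (C : Ctx N m C0 C1 θ g G k P T u Vn Vc ac H M) (Z : Par0 P T k κ kp r s a b)
    {A E0 : Set (EuclideanSpace ℝ (Fin N) × ℝ)} (hA : MeasurableSet A) (hAf : volume A ≠ ⊤)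
    (hAs : ∀ p ∈ cbox N s ×ˢ Ico a 0, u p < kp → p ∈ A) {τ h R : ℝ} (hτ : τ < 0) (hh : 0 ≤ h)
    (hE : MeasurableSet E0)
    (hEs : ∀ p ∈ E0, p.1 ∈ cbox N r ∧ b ≤ p.2 ∧ p.2 ≤ τ ∧ u p ≤ kp - h) :
    (h ^ 3 * volume.real (Metric.ball (0 : EuclideanSpace ℝ (Fin N)) R) -
      3 * eB N m C0 C1 θ k P κ G (volume.real A)) * volume.real E0 ≤
      volume.real (Metric.ball (0 : EuclideanSpace ℝ (Fin N)) R) *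
        (R * (N * (c3 N m C0 C1 θ * (κ ^ m)⁻¹ * (k ^ 3 / P) * volume.real A))) := by
  have hP := C.hP
  have hT := C.hT
  have hk := C.hk
  have hκ := Z.hκ
  have hm0 : m ≠ 0 := by have := C.hm; omega
  have hrs : r < s := by have : 0 < κ * P / 2 := by positivity
                         linarith [Z.hrs]
  have hab : a < b := by have : 0 < κ * T / 2 := by positivity
                         linarith [Z.hab]
  have hcd : τ < τ / 2 := by linarith
  have hd : τ / 2 < 0 := by linarith
  have Y := Z.par hcd hd
  set ζ := ctf N m r s a b τ (τ / 2) with hζ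
  have hζc : HasCompactSupport ζ := ctf_compact hm0 hrs hab hcd
  have hζi : Integrable ζ volume := (ctf_contDiff.continuous).integrable_of_hasCompactSupport hζc
  have v0 : ∀ p, 0 ≤ trc kp (u p) ^ 3 := fun p => pow_nonneg (trc_nonneg _ _) 3
  have vk : ∀ p, trc kp (u p) ^ 3 ≤ k ^ 3 := fun p =>
    pow_le_pow_left₀ (trc_nonneg _ _) (trc_le (C.u_nonneg _) Z.hkp hk.le) 3
  have vm : Measurable fun p => trc kp (u p) ^ 3 :=
    ((trc_cont kp).measurable.comp C.u_meas).pow_const 3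
  have hwm : Measurable fun p => trc kp (u p) ^ 3 * ζ p :=
    vm.mul (ctf_contDiff.continuous).measurable
  have hwi : Integrable (fun p => trc kp (u p) ^ 3 * ζ p) volume := by
    refine (Integrable.mul_bdd (c := k ^ 3) hζi (g := fun p => trc kp (u p) ^ 3)
      vm.aestronglyMeasurable ?_).congr (Eventually.of_forall fun x => mul_comm _ _)
    refine Eventually.of_forall fun x => ?_
    rw [Real.norm_eq_abs, abs_of_nonneg (v0 x)]
    exact vk x
  have hEf : volume E0 ≠ ⊤ := by
    refine ne_top_of_le_ne_top ?_ (measure_mono (t := cbox N r ×ˢ Icc b τ) ?_)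
    · exact ((cbox_compact r).prod isCompact_Icc).measure_lt_top.ne
    · intro p hp
      obtain ⟨h1, h2, h3, -⟩ := hEs p hp
      exact ⟨h1, h2, h3⟩
  have hsup : tsupport ζ ⊆ cube N 0 P ×ˢ Ioo (-T) 0 := by
    refine (ctf_tsupport hm0 hrs hab hcd).trans fun p hp => ⟨fun i => ?_, ?_, ?_⟩
    · simpa using lt_of_le_of_lt (hp.1 i) Z.hsP
    · exact lt_of_lt_of_le Z.haT hp.2.1
    · exact lt_of_le_of_lt hp.2.2 hd
  have hsl0 : ∀ t, (fun x => trc kp (u (x, t)) ^ 3 * ζ (x, t)) =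
      fun x => (trc kp (u (x, t)) ^ 3 * spc N r s x ^ m) * tmc a b τ (τ / 2) t := by
    intro t; ext x; simp only [hζ, ctf]; ring
  set D := c3 N m C0 C1 θ * (κ ^ m)⁻¹ * (k ^ 3 / P) * volume.real A with hD
  refine ball_avg hwm hwi (fun p => mul_nonneg (v0 p) (ctf_nonneg p)) (B := k ^ 3)
    (fun p => (mul_le_of_le_one_right (v0 p) (ctf_le_one p)).trans (vk p)) hE hEf ?_ ?_ ?_ ?_
  · intro y hy
    have h1 := C.D.trans (f := fun s => trc kp s ^ 3) (trc_h kp)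
      (by have := trc_cont kp; fun_prop) (ctf_contDiff (N := N) (m := m) (r := r) (s := s)
        (a := a) (b := b) (c := τ) (d := τ / 2)) hζc hsup (fun i => y i)
    have h2 : ∑ i, y i • dirx N i = (y, 0) := by
      have : y = ∑ i, y i • EuclideanSpace.single i (1:ℝ) := by
        ext j; simp [Finset.sum_apply, Pi.single_apply]
      ext1
      · rw [Prod.fst_sum]; simp only [dirx, Prod.smul_fst]; exact this.symm
      · rw [Prod.snd_sum]; simp [dirx]
    rw [h2] at h1
    refine h1.trans ?_
    have h3 : ∀ i ∈ (Finset.univ : Finset (Fin N)), |y i| *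
        ((∫ p, |Vc i p * (-(3 * trc kp (u p) ^ 2) * ctf N m r s a b τ (τ / 2) p)|) +
      ∫ p, |trc kp (u p) ^ 3 * fderiv ℝ (ctf N m r s a b τ (τ / 2)) p (dirx N i)|) ≤ R * D := by
      intro i _
      have e1 : |y i| ≤ R := (by simpa using PiLp.norm_apply_le y i : |y i| ≤ ‖y‖).trans hy.le
      have e2 := C.grad Y hA hAf (fun p hp => hAs p ⟨hp.1, hp.2.1, lt_of_le_of_lt hp.2.2 hd⟩) i
      refine mul_le_mul e1 e2 (add_nonneg (integral_nonneg fun _ => abs_nonneg _)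
        (integral_nonneg fun _ => abs_nonneg _)) ((abs_nonneg _).trans e1)
    refine (Finset.sum_le_sum h3).trans (le_of_eq ?_)
    rw [Finset.sum_const, Finset.card_univ, Fintype.card_fin, nsmul_eq_mul]; ring
  · intro p hp
    obtain ⟨h1, h2, h3, h4⟩ := hEs p hp
    have : ζ p = 1 := by
      rw [hζ, ctf, spc_one hrs h1, one_pow, tmc_one hab hcd h2 h3, one_mul]
    rw [this, mul_one]
    exact pow_le_pow_left₀ hh (le_trans (by linarith) (le_max_left _ _)) 3
  · intro t
    rw [hsl0]
    exact (C.slice_int hrs Z.hkp t).mul_const _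
  · intro p hp
    obtain ⟨h1, h2, h3, h4⟩ := hEs p hp
    rw [hsl0, integral_mul_const]
    refine (mul_le_of_le_one_right (integral_nonneg fun x => ?_) (tmc_le_one _ _ _ _ _)).trans
      (C.slice Z hA hAf hAs h2 (lt_of_le_of_lt h3 hτ))
    exact mul_nonneg (v0 _) (pow_nonneg (spc_nonneg _ _ _) _)

lemma Ctx.step (C : Ctx N m C0 C1 θ g G k P T u Vn Vc ac H M) (Z : Par0 P T k κ kp r s a b)
    {A E0 : Set (EuclideanSpace ℝ (Fin N) × ℝ)} (hA : MeasurableSet A) (hAf : volume A ≠ ⊤)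
    (hAs : ∀ p ∈ cbox N s ×ˢ Ico a 0, u p < kp → p ∈ A) {h R : ℝ} (hh : 0 ≤ h)
    (hE : MeasurableSet E0) (hEf : volume E0 ≠ ⊤)
    (hEs : ∀ p ∈ E0, p.1 ∈ cbox N r ∧ b ≤ p.2 ∧ p.2 < 0 ∧ u p ≤ kp - h) :
    (h ^ 3 * volume.real (Metric.ball (0 : EuclideanSpace ℝ (Fin N)) R) -
      3 * eB N m C0 C1 θ k P κ G (volume.real A)) * volume.real E0 ≤
      volume.real (Metric.ball (0 : EuclideanSpace ℝ (Fin N)) R) *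
        (R * (N * (c3 N m C0 C1 θ * (κ ^ m)⁻¹ * (k ^ 3 / P) * volume.real A))) := by
  set E : ℕ → Set (EuclideanSpace ℝ (Fin N) × ℝ) :=
    fun n => E0 ∩ {p | p.2 ≤ -(1 / ((n : ℝ) + 1))} with hEd
  have hmono : Monotone E := by
    intro i j hij p hp
    refine ⟨hp.1, le_trans (b := -(1 / ((i : ℝ) + 1))) hp.2 ?_⟩
    exact neg_le_neg (one_div_le_one_div_of_le (by positivity) (by gcongr))
  have hU : ⋃ n, E n = E0 := by
    ext p
    simp only [mem_iUnion]
    refine ⟨fun ⟨n, hn⟩ => hn.1, fun hp => ?_⟩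
    obtain ⟨n, hn⟩ := exists_nat_one_div_lt (by linarith [(hEs p hp).2.2.1] : 0 < -p.2)
    exact ⟨n, hp, by show p.2 ≤ _; linarith⟩
  have ht : Tendsto (fun n => volume.real (E n)) atTop (𝓝 (volume.real E0)) := by
    have := tendsto_measure_iUnion_atTop (μ := volume) hmono
    rw [hU] at this
    exact (ENNReal.tendsto_toReal hEf).comp this
  refine le_of_tendsto' (ht.const_mul _) fun n => ?_
  refine C.step_pre Z hA hAf hAs (τ := -(1 / ((n : ℝ) + 1))) ?_ hh ?_ ?_
  · have : (0:ℝ) < 1 / ((n : ℝ) + 1) := by positivity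
    linarith
  · exact hE.inter (measurableSet_le measurable_snd measurable_const)
  · intro p hp
    obtain ⟨h1, h2, h3, h4⟩ := hEs p hp.1
    exact ⟨h1, h2, hp.2, h4⟩

end Trans

section Iter
open Filter Topology

lemma c2_pos {N m : ℕ} {C0 C1 θ : ℝ} (hC0 : 0 < C0) (hθ : 0 < θ) : 0 < c2 N m C0 C1 θ := by
  have h1 := cS_one
  have h2 : 1 ≤ c4 N m C0 C1 := le_max_left _ _
  unfold c2 c5
  positivity

lemma c3_pos {N m : ℕ} {C0 C1 θ : ℝ} (hC0 : 0 < C0) (hθ : 0 < θ) : 0 < c3 N m C0 C1 θ := by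
  have h1 := cS_one
  have h2 := c2_pos (N := N) (m := m) (C1 := C1) hC0 hθ
  unfold c3
  positivity

/-- volume of the unit ball -/
def omg (N : ℕ) : ℝ := volume.real (Metric.ball (0 : EuclideanSpace ℝ (Fin N)) 1)

lemma omg_pos (N : ℕ) : 0 < omg N :=
  ENNReal.toReal_pos (Metric.measure_ball_pos _ _ one_pos).ne' Metric.isBounded_ball.measure_lt_top.ne

lemma ball_vol {N : ℕ} {R : ℝ} (hR : 0 < R) :
    volume.real (Metric.ball (0 : EuclideanSpace ℝ (Fin N)) R) = R ^ N * omg N := by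
  rw [omg, Measure.real, Measure.addHaar_ball_of_pos _ _ hR, ENNReal.toReal_mul,
    ENNReal.toReal_ofReal (by positivity), finrank_euclideanSpace, Fintype.card_fin]; rfl

variable {N m : ℕ} {C0 C1 θ : ℝ} {g G : ℝ → ℝ} {k P T : ℝ}
    {u Vn : EuclideanSpace ℝ (Fin N) × ℝ → ℝ} {Vc ac : Fin N → EuclideanSpace ℝ (Fin N) × ℝ → ℝ}
    {H : EuclideanSpace ℝ (Fin N) × ℝ → ℝ} {M : ℝ}
variable {κ kp r s a b : ℝ}

lemma Ctx.stepN (C : Ctx N m C0 C1 θ g G k P T u Vn Vc ac H M) (Z : Par0 P T k κ kp r s a b)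
    {A E0 : Set (EuclideanSpace ℝ (Fin N) × ℝ)} (hA : MeasurableSet A) (hAf : volume A ≠ ⊤)
    (hAs : ∀ p ∈ cbox N s ×ˢ Ico a 0, u p < kp → p ∈ A)
    (hE : MeasurableSet E0) (hEf : volume E0 ≠ ⊤)
    (hEs : ∀ p ∈ E0, p.1 ∈ cbox N r ∧ b ≤ p.2 ∧ p.2 < 0 ∧ u p ≤ kp - κ * k)
    {ϱ : ℝ} (hϱ : 0 < ϱ)
    (hS : 6 * c2 N m C0 C1 θ * θ * volume.real A ≤ κ ^ (m + 3) * omg N * ϱ ^ N * (P ^ N * T)) :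
    volume.real E0 * κ ^ (m + 3) ≤ 2 * N * c3 N m C0 C1 θ * ϱ * volume.real A := by
  have hP := C.hP
  have hT := C.hT
  have hk := C.hk
  have hκ := Z.hκ
  have hω := omg_pos N
  have h1 := C.step Z hA hAf hAs (h := κ * k) (R := ϱ * P) (by positivity) hE hEf hEs
  rw [ball_vol (by positivity)] at h1
  set S := volume.real A with hSd
  set W := (ϱ * P) ^ N * omg N with hW
  have hWp : 0 < W := by positivity
  have hγ : G (k / P) = θ * k ^ 2 / T := by rw [eq_div_iff hT.ne']; linarith [C.hTeq]
  have h2 : 3 * eB N m C0 C1 θ k P κ G S ≤ (κ * k) ^ 3 * W / 2 := by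
    have e : 3 * eB N m C0 C1 θ k P κ G S =
        (k ^ 3 / (2 * T * κ ^ m)) * (6 * c2 N m C0 C1 θ * θ * S) := by
      unfold eB; rw [hγ]; field_simp; ring
    rw [e]
    refine (mul_le_mul_of_nonneg_left hS (by positivity)).trans (le_of_eq ?_)
    rw [hW, mul_pow κ k, mul_pow ϱ P, pow_add]; field_simp
  have h3 : (κ * k) ^ 3 * W / 2 * volume.real E0 ≤
      W * (ϱ * P * (N * (c3 N m C0 C1 θ * (κ ^ m)⁻¹ * (k ^ 3 / P) * S))) := by
    refine le_trans (mul_le_mul_of_nonneg_right ?_ measureReal_nonneg) h1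
    linarith
  have h4 : (κ * k) ^ 3 * W / 2 * volume.real E0 =
      (k ^ 3 * W / (2 * κ ^ m)) * (volume.real E0 * κ ^ (m + 3)) := by
    rw [pow_add]; field_simp
  have h5 : W * (ϱ * P * (N * (c3 N m C0 C1 θ * (κ ^ m)⁻¹ * (k ^ 3 / P) * S))) =
      (k ^ 3 * W / (2 * κ ^ m)) * (2 * N * c3 N m C0 C1 θ * ϱ * S) := by
    field_simp
  rw [h4, h5] at h3
  exact le_of_mul_le_mul_left h3 (by positivity)

/-- shrinking factor -/
def shr (n : ℕ) : ℝ := (1 + (1 / 2) ^ n) / 2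

lemma shr_succ (n : ℕ) : shr n - shr (n + 1) = (1 / 2) ^ (n + 2) := by
  unfold shr; ring

lemma shr_le (n : ℕ) : shr n ≤ 1 := by
  have : ((1:ℝ) / 2) ^ n ≤ 1 := pow_le_one₀ (by norm_num) (by norm_num)
  unfold shr; linarith

lemma half_le_shr (n : ℕ) : 1 / 2 ≤ shr n := by
  have : 0 ≤ ((1:ℝ) / 2) ^ n := by positivity
  unfold shr; linarith

/-- sublevel set in the cylinder shrunk by `σ` -/
def Asub (u : EuclideanSpace ℝ (Fin N) × ℝ → ℝ) (k P T σ : ℝ) :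
    Set (EuclideanSpace ℝ (Fin N) × ℝ) :=
  {p | p ∈ cube N 0 (σ * P) ×ˢ Ioo (-(σ * T)) 0 ∧ u p < σ * k}

lemma cube_open (R : ℝ) : IsOpen (cube N 0 R) := by
  have : cube N 0 R = ⋂ i, {x | |x i - (0 : EuclideanSpace ℝ (Fin N)) i| < R} := by
    ext x; simp [cube]
  rw [this]
  exact isOpen_iInter_of_finite fun i => isOpen_lt (by fun_prop) continuous_const

lemma Asub_meas (hu : Measurable u) (σ : ℝ) : MeasurableSet (Asub u k P T σ) :=
  (((cube_open _).measurableSet.prod measurableSet_Ioo)).inter (measurableSet_lt hu measurable_const)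

lemma Asub_fin (σ : ℝ) : volume (Asub u k P T σ) ≠ ⊤ := by
  refine ne_top_of_le_ne_top ?_ (measure_mono (t := cbox N (σ * P) ×ˢ Icc (-(σ * T)) 0) ?_)
  · exact ((cbox_compact _).prod isCompact_Icc).measure_lt_top.ne
  · intro p hp
    refine ⟨fun i => ?_, hp.1.2.1.le, hp.1.2.2.le⟩
    simpa using (hp.1.1 i).le

lemma Asub_mono (hk : 0 ≤ k) (hP : 0 ≤ P) (hT : 0 ≤ T) {σ σ' : ℝ} (h : σ ≤ σ') :
    Asub u k P T σ ⊆ Asub u k P T σ' := by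
  intro p hp
  have h1 := mul_le_mul_of_nonneg_right h hk
  have h2 := mul_le_mul_of_nonneg_right h hP
  have h3 := mul_le_mul_of_nonneg_right h hT
  refine ⟨⟨fun i => (hp.1.1 i).trans_le h2, ?_, hp.1.2.2⟩, hp.2.trans_le h1⟩
  have := hp.1.2.1
  linarith

lemma Ctx.iter_step (C : Ctx N m C0 C1 θ g G k P T u Vn Vc ac H M) (n : ℕ) {ϱ : ℝ} (hϱ : 0 < ϱ)
    (hS : 6 * c2 N m C0 C1 θ * θ * volume.real (Asub u k P T (shr n)) ≤
      ((1 / 2) ^ (n + 2)) ^ (m + 3) * omg N * ϱ ^ N * (P ^ N * T)) :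
    volume.real (Asub u k P T (shr (n + 1))) * ((1 / 2) ^ (n + 2)) ^ (m + 3) ≤
      2 * N * c3 N m C0 C1 θ * ϱ * volume.real (Asub u k P T (shr n)) := by
  have hP := C.hP
  have hT := C.hT
  have hk := C.hk
  set κ : ℝ := (1 / 2) ^ (n + 2) with hκd
  have hκ : 0 < κ := by positivity
  have hκ1 : κ ≤ 1 := pow_le_one₀ (by norm_num) (by norm_num)
  have e := shr_succ n
  rw [← hκd] at e
  have l1 := shr_le n
  have l2 := shr_le (n + 1)
  set x := shr n
  set y := shr (n + 1)
  have hx : x = y + κ := by linarith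
  have hκP : 0 < κ * P := by positivity
  have hκT : 0 < κ * T := by positivity
  have hxP : x * P ≤ P := by nlinarith
  have hxT : x * T ≤ T := by nlinarith
  have Z : Par0 P T k κ (x * k) (y * P) (y * P + κ * P / 2) (-(y * T) - κ * T / 2) (-(y * T)) := by
    refine ⟨hκ, hκ1, by nlinarith, by linarith, ?_, by linarith, ?_⟩
    · rw [hx] at hxP; linarith
    · rw [hx] at hxT; linarith
  refine C.stepN Z (Asub_meas C.u_meas _) (Asub_fin _) ?_ (Asub_meas C.u_meas _) (Asub_fin _) ?_ hϱ hS
  · intro p hp hu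
    refine ⟨⟨fun i => ?_, ?_, hp.2.2⟩, hu⟩
    · have := hp.1 i
      have h0 : |p.1 i - (0 : EuclideanSpace ℝ (Fin N)) i| = |p.1 i| := by simp
      rw [h0, hx]; linarith
    · have := hp.2.1
      rw [hx]; linarith
  · intro p hp
    refine ⟨fun i => ?_, hp.1.2.1.le, hp.1.2.2, ?_⟩
    · have := hp.1.1 i
      have h0 : |p.1 i - (0 : EuclideanSpace ℝ (Fin N)) i| = |p.1 i| := by simp
      rw [h0] at this; exact this.le
    · have := hp.2
      rw [hx]; linarith

theorem dg_iter (N m : ℕ) (C0 C1 θ : ℝ) (hC0 : 0 < C0) (hθ : 0 < θ) : ∃ ν : ℝ, 0 < ν ∧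
    ∀ (g G : ℝ → ℝ) (k P T : ℝ) (u Vn : EuclideanSpace ℝ (Fin N) × ℝ → ℝ)
      (Vc ac : Fin N → EuclideanSpace ℝ (Fin N) × ℝ → ℝ)
      (H : EuclideanSpace ℝ (Fin N) × ℝ → ℝ) (M : ℝ),
      Ctx N m C0 C1 θ g G k P T u Vn Vc ac H M →
      volume.real (Asub u k P T 1) ≤ ν * (P ^ N * T) → volume (Asub u k P T (1 / 2)) = 0 := by
  have p2 := c2_pos (N := N) (m := m) (C1 := C1) hC0 hθ
  have p3 := c3_pos (N := N) (m := m) (C1 := C1) hC0 hθ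
  have hω := omg_pos N
  set q := m + 3 with hq
  set μ : ℝ := (1 / 2) ^ q with hμ
  have hμ0 : 0 < μ := by positivity
  have hμ1 : μ ≤ 1 / 2 := by
    rw [hμ]; exact pow_le_of_le_one (by norm_num) (by norm_num) (by omega)
  set l : ℝ := μ ^ (N + 1) with hl
  have hl0 : 0 < l := by positivity
  have hl1 : l < 1 := pow_lt_one₀ hμ0.le (by linarith) (by omega)
  set D : ℝ := 2 * N * c3 N m C0 C1 θ with hD
  have hD0 : 0 ≤ D := by positivity
  set ε : ℝ := l * μ ^ 2 / (D + 1) with hε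
  have hε0 : 0 < ε := by positivity
  set ν : ℝ := μ ^ 2 * omg N * ε ^ N / (6 * c2 N m C0 C1 θ * θ) with hν
  have hν0 : 0 < ν := by positivity
  refine ⟨ν, hν0, ?_⟩
  intro g G k P T u Vn Vc ac H M C h0
  have hP := C.hP
  have hT := C.hT
  have hk := C.hk
  have hκ : ∀ n : ℕ, (((1:ℝ) / 2) ^ (n + 2)) ^ q = μ ^ n * μ ^ 2 := by
    intro n; rw [hμ, ← pow_add, ← pow_mul, ← pow_mul, mul_comm]
  have key : ∀ n, volume.real (Asub u k P T (shr n)) ≤ ν * l ^ n * (P ^ N * T) := by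
    intro n
    induction n with
    | zero => simpa [shr] using h0
    | succ n ih =>
      have h1 := C.iter_step n (ϱ := ε * μ ^ n) (by positivity) ?_
      · rw [← hq, hκ, ← hD] at h1
        set S := volume.real (Asub u k P T (shr n))
        have hS0 : 0 ≤ S := measureReal_nonneg
        have h2 : D * (ε * μ ^ n) * S ≤ (l * S) * (μ ^ n * μ ^ 2) := by
          have : D * ε ≤ l * μ ^ 2 := by
            rw [hε, mul_div_assoc', div_le_iff₀ (by positivity)]
            have : 0 < l * μ ^ 2 := by positivity
            nlinarith
          calc D * (ε * μ ^ n) * S = (D * ε) * (μ ^ n * S) := by ring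
            _ ≤ (l * μ ^ 2) * (μ ^ n * S) := by gcongr
            _ = _ := by ring
        have h3 := le_of_mul_le_mul_right (h1.trans h2) (by positivity)
        refine h3.trans ?_
        calc l * S ≤ l * (ν * l ^ n * (P ^ N * T)) := by gcongr
          _ = _ := by ring
      · rw [← hq, hκ]
        refine (mul_le_mul_of_nonneg_left ih (by positivity)).trans (le_of_eq ?_)
        rw [hν, hl]
        have : (μ ^ (N + 1)) ^ n = μ ^ n * (μ ^ n) ^ N := by
          ring
        rw [this, mul_pow]
        field_simp
  have hle : ∀ n, volume.real (Asub u k P T (1 / 2)) ≤ ν * l ^ n * (P ^ N * T) := fun n =>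
    (measureReal_mono (Asub_mono hk.le hP.le hT.le (half_le_shr n)) (Asub_fin _)).trans (key n)
  have hlim : Tendsto (fun n => ν * l ^ n * (P ^ N * T)) atTop (𝓝 (ν * 0 * (P ^ N * T))) :=
    ((tendsto_pow_atTop_nhds_zero_of_lt_one hl0.le hl1).const_mul _).mul_const _
  have hz := ge_of_tendsto' hlim hle
  rw [mul_zero, zero_mul] at hz
  have := le_antisymm hz measureReal_nonneg
  exact (measureReal_eq_zero_iff (Asub_fin _)).mp this

end Iter

section Assemble
open Filter Topology

lemma cube_vol_le {N : ℕ} {P : ℝ} (hP : 0 < P) :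
    volume (cube N 0 P) ≤ ENNReal.ofReal (((N + 1) * P) ^ N * omg N) := by
  have h1 : cube N 0 P ⊆ Metric.ball 0 ((N + 1) * P) := by
    intro x hx
    rw [mem_ball_zero_iff]
    have h2 : ‖x‖ ≤ ∑ i, ‖x i‖ := by
      have h1 : x = ∑ i, x i • EuclideanSpace.single i (1:ℝ) := by
        ext j; simp [Finset.sum_apply, Pi.single_apply]
      calc ‖x‖ = ‖∑ i, x i • EuclideanSpace.single i (1:ℝ)‖ := by rw [← h1]
        _ ≤ ∑ i, ‖x i • EuclideanSpace.single i (1:ℝ)‖ := norm_sum_le _ _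
        _ = _ := by simp [norm_smul]
    have h3 : ∑ i, ‖x i‖ ≤ ∑ _i : Fin N, P := Finset.sum_le_sum fun i _ => by
      simpa using (hx i).le
    rw [Finset.sum_const, Finset.card_univ, Fintype.card_fin, nsmul_eq_mul] at h3
    nlinarith
  refine (measure_mono h1).trans ?_
  rw [← ball_vol (by positivity), Measure.real,
    ENNReal.ofReal_toReal Metric.isBounded_ball.measure_lt_top.ne]

lemma cube_fin {N : ℕ} {P : ℝ} (hP : 0 < P) : volume (cube N 0 P) < ⊤ :=
  (cube_vol_le hP).trans_lt ENNReal.ofReal_lt_top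

lemma ae_snd_ne {N : ℕ} (c : ℝ) : ∀ᵐ p : EuclideanSpace ℝ (Fin N) × ℝ, p.2 ≠ c := by
  have h : ∀ᵐ t : ℝ, t ≠ c := by simp [ae_iff]
  exact Measure.quasiMeasurePreserving_snd.ae h

lemma buildCtx {N m : ℕ} {C0 C1 θ : ℝ} {g G : ℝ → ℝ} {k P T : ℝ} (hm : 2 ≤ m) (hC0 : 0 < C0)
    (hC1 : 0 < C1) (hθ : 0 < θ) (D : GData g G m) (hk : 0 < k) (hP : 0 < P) (hT : 0 < T)
    (hTeq : T * G (k / P) = θ * k ^ 2)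
    {u : EuclideanSpace ℝ (Fin N) → ℝ → ℝ}
    {V : EuclideanSpace ℝ (Fin N) → ℝ → EuclideanSpace ℝ (Fin N)}
    (h : IsBoundedWeakSolution N C0 C1 g G (cube N 0 P) (-T) 0 u V)
    (hu : ∀ x ∈ cube N 0 P, ∀ t ∈ Ioo (-T) 0, 0 ≤ u x t) :
    ∃ Vn Vc ac H M, Ctx N m C0 C1 θ g G k P T
      ((cube N 0 P ×ˢ Ioo (-T) 0).indicator fun p => u p.1 p.2) Vn Vc ac H M := by
  obtain ⟨a, H, M, hD, ham, hae⟩ := buildMData hC1 D (cube_open P) (cube_fin hP)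
    (by linarith : -T < 0) h
  set Q := cube N 0 P ×ˢ Ioo (-T) 0 with hQ
  have hQo : IsOpen Q := (cube_open P).prod isOpen_Ioo
  have hQm : MeasurableSet Q := hQo.measurableSet
  refine ⟨Q.indicator fun p => ‖V p.1 p.2‖, _, _, H, M, hD, D, hm, hC0, hC1, hθ, hk, hP, hT, hTeq,
    ?_, ?_, ?_, ?_, ?_, ?_, ?_, ?_⟩
  · exact fun p => indicator_nonneg (fun _ _ => norm_nonneg _) p
  · intro i p
    by_cases hp : p ∈ Q
    · simp only [indicator_of_mem hp]
      simpa using PiLp.norm_apply_le (V p.1 p.2) i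
    · simp [indicator_of_notMem hp]
  · have h1 := (integrable_indicator_iff hQm).mpr h.grad_G_integrable
    refine h1.congr (Eventually.of_forall fun p => ?_)
    by_cases hp : p ∈ Q
    · simp only [indicator_of_mem hp]
    · simp [indicator_of_notMem hp, D.zero]
  · filter_upwards [hae] with p hp
    by_cases h' : p ∈ Q
    · simp only [indicator_of_mem h']; exact (hp h').1
    · simp [indicator_of_notMem h', D.zero]
  · filter_upwards [hae] with p hp i
    by_cases h' : p ∈ Q
    · simp only [indicator_of_mem h']
      refine le_trans ?_ (hp h').2
      simpa using PiLp.norm_apply_le (a p) i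
    · simp only [indicator_of_notMem h', abs_zero]
      exact mul_nonneg hC1.le (D.nonneg 0 le_rfl)
  · exact fun p => indicator_nonneg (fun q hq => hu _ hq.1 _ hq.2) p
  · classical
    have h1 := h.continuousOn.measurable_piecewise (f := fun p => u p.1 p.2)
      (g := fun _ => (0:ℝ)) continuousOn_const hQm
    have h2 : Q.indicator (fun p => u p.1 p.2) = Q.piecewise (fun p => u p.1 p.2) fun _ => 0 :=
      (Set.piecewise_eq_indicator (s := Q) (f := fun p => u p.1 p.2)).symm
    rw [h2]; exact h1
  · exact h.continuousOn.congr fun p hp => indicator_of_mem hp _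

end Assemble

/-- De Giorgi-type iteration: with `T_{k,ρ} = θ k² G(k/ρ)⁻¹` and
`Q_{k,ρ} = K_ρ × [-T_{k,ρ}, 0]`, there is `ν0 ∈ (0,1)`, depending only on the data
and `θ`, such that any nonnegative bounded weak solution on (the interior of)
`Q_{k,2ρ}` with `meas{(x,t) ∈ Q_{k,2ρ} : u < k} < ν0 · meas Q_{k,2ρ}` satisfies
`ess inf_{Q_{k,ρ}} u ≥ k/2`. -/
theorem deGiorgi_iteration (N : ℕ) (hN : 1 ≤ N) (C0 C1 g0 g1 θ : ℝ)
    (hC0 : 0 < C0) (hC1 : 0 < C1) (hg0 : 1 < g0) (hg01 : g0 ≤ g1) (hθ : 0 < θ) :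
    ∃ ν0 ∈ Set.Ioo (0:ℝ) 1,
    ∀ g G : ℝ → ℝ, Continuous g → MonotoneOn g (Set.Ici 0) →
      (∀ σ : ℝ, 0 ≤ σ → 0 ≤ g σ) → (∀ σ : ℝ, 0 < σ → 0 < g σ) →
      (∀ σ : ℝ, G σ = ∫ τ in (0:ℝ)..σ, g τ) →
      (∀ σ : ℝ, 0 < σ → g0 * G σ ≤ σ * g σ) → (∀ σ : ℝ, 0 < σ → σ * g σ ≤ g1 * G σ) →
    ∀ k ρ : ℝ, 0 < k → 0 < ρ →
    ∀ (u : EuclideanSpace ℝ (Fin N) → ℝ → ℝ)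
      (V : EuclideanSpace ℝ (Fin N) → ℝ → EuclideanSpace ℝ (Fin N)),
      IsBoundedWeakSolution N C0 C1 g G (cube N 0 (2 * ρ))
        (-(θ * k ^ 2 * (G (k / (2 * ρ)))⁻¹)) 0 u V →
      (∀ x ∈ cube N 0 (2 * ρ),
        ∀ t ∈ Set.Ioo (-(θ * k ^ 2 * (G (k / (2 * ρ)))⁻¹)) (0:ℝ), 0 ≤ u x t) →
      volume {p : EuclideanSpace ℝ (Fin N) × ℝ |
          p ∈ (cube N 0 (2 * ρ)) ×ˢ Set.Icc (-(θ * k ^ 2 * (G (k / (2 * ρ)))⁻¹)) 0 ∧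
          u p.1 p.2 < k} <
        ENNReal.ofReal ν0 *
          volume ((cube N 0 (2 * ρ)) ×ˢ Set.Icc (-(θ * k ^ 2 * (G (k / (2 * ρ)))⁻¹)) 0) →
      ∀ᵐ p : EuclideanSpace ℝ (Fin N) × ℝ,
        p ∈ (cube N 0 ρ) ×ˢ Set.Icc (-(θ * k ^ 2 * (G (k / ρ))⁻¹)) 0 →
          k / 2 ≤ u p.1 p.2 := by
  classical
  obtain ⟨m, hm2, hmg⟩ : ∃ m : ℕ, 2 ≤ m ∧ g1 ≤ m := by
    obtain ⟨n, hn⟩ := exists_nat_ge g1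
    exact ⟨max n 2, le_max_right _ _, hn.trans (by exact_mod_cast le_max_left _ _)⟩
  obtain ⟨ν, hν, hiter⟩ := dg_iter N m C0 C1 θ hC0 hθ
  have hω := omg_pos N
  set c : ℝ := ((N : ℝ) + 1) ^ N * omg N with hc
  have hc0 : 0 < c := by positivity
  refine ⟨min (1 / 2) (ν / c), ⟨lt_min (by norm_num) (by positivity),
    (min_le_left _ _).trans_lt (by norm_num)⟩, ?_⟩
  intro g G hgc hgm hg0' hgp hG hlow hup k ρ hk hρ u V hsol hu hmeas
  have D : GData g G m := by
    refine ⟨hgc, hgm, hg0', hgp, hG, fun σ hσ => (hup σ hσ).trans ?_⟩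
    have : 0 ≤ G σ := by
      rw [hG]
      exact intervalIntegral.integral_nonneg hσ.le fun x hx => hg0' x hx.1
    exact mul_le_mul_of_nonneg_right hmg this
  have hP : 0 < 2 * ρ := by positivity
  have hγ : 0 < G (k / (2 * ρ)) := D.G_pos (by positivity)
  have hγ1 : 0 < G (k / ρ) := D.G_pos (by positivity)
  have hTT : θ * k ^ 2 * (G (k / ρ))⁻¹ ≤ 1 / 2 * (θ * k ^ 2 * (G (k / (2 * ρ)))⁻¹) := by
    have h2 := D.two (r := k / (2 * ρ)) (by positivity)
    have h3 : 2 * (k / (2 * ρ)) = k / ρ := by field_simp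
    rw [h3] at h2
    have h4 : (G (k / ρ))⁻¹ ≤ (2 * G (k / (2 * ρ)))⁻¹ := inv_anti₀ (by positivity) h2
    calc _ ≤ θ * k ^ 2 * (2 * G (k / (2 * ρ)))⁻¹ := by gcongr
      _ = _ := by rw [mul_inv]; ring
  have hT : 0 < θ * k ^ 2 * (G (k / (2 * ρ)))⁻¹ := by positivity
  have hTeq : θ * k ^ 2 * (G (k / (2 * ρ)))⁻¹ * G (k / (2 * ρ)) = θ * k ^ 2 := by field_simp
  generalize θ * k ^ 2 * (G (k / (2 * ρ)))⁻¹ = T at *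
  generalize θ * k ^ 2 * (G (k / ρ))⁻¹ = T' at *
  obtain ⟨Vn, Vc, ac, H, M, C⟩ := buildCtx hm2 hC0 hC1 hθ D hk hP hT hTeq hsol hu
  set Q := cube N 0 (2 * ρ) ×ˢ Ioo (-T) 0 with hQ
  have hz := hiter g G k (2 * ρ) T _ Vn Vc ac H M C ?_
  · have hae : ∀ᵐ p, p ∉ Asub (Q.indicator fun p => u p.1 p.2) k (2 * ρ) T (1 / 2) :=
      measure_eq_zero_iff_ae_notMem.mp hz
    filter_upwards [hae, ae_snd_ne 0, ae_snd_ne (-(1 / 2 * T))] with p hp h0 h1 hpQ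
    by_contra hlt
    push Not at hlt
    have ht1 : p.2 < 0 := lt_of_le_of_ne hpQ.2.2 h0
    have ht2 : -(1 / 2 * T) < p.2 := lt_of_le_of_ne (by linarith [hpQ.2.1]) (Ne.symm h1)
    have hpin : p ∈ Q := by
      refine ⟨fun i => ?_, by linarith, ht1⟩
      have := hpQ.1 i
      linarith
    refine hp ⟨⟨fun i => ?_, ht2, ht1⟩, ?_⟩
    · have := hpQ.1 i
      linarith
    · rw [indicator_of_mem hpin]
      linarith
  · have hsub : Asub (Q.indicator fun p => u p.1 p.2) k (2 * ρ) T 1 ⊆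
        {p : EuclideanSpace ℝ (Fin N) × ℝ |
          p ∈ (cube N 0 (2 * ρ)) ×ˢ Set.Icc (-T) 0 ∧ u p.1 p.2 < k} := by
      intro p hp
      have h1 : p ∈ Q := by simpa [hQ] using hp.1
      have h2 := hp.2
      rw [indicator_of_mem h1, one_mul] at h2
      exact ⟨⟨h1.1, h1.2.1.le, h1.2.2.le⟩, h2⟩
    have hle := (measure_mono hsub).trans hmeas.le
    have hvol : volume ((cube N 0 (2 * ρ)) ×ˢ Set.Icc (-T) 0) ≤
        ENNReal.ofReal (c * ((2 * ρ) ^ N * T)) := by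
      rw [Measure.volume_eq_prod, Measure.prod_prod, Real.volume_Icc]
      refine (mul_le_mul_left (cube_vol_le hP) _).trans ?_
      rw [← ENNReal.ofReal_mul (by positivity)]
      refine ENNReal.ofReal_le_ofReal (le_of_eq ?_)
      rw [hc, mul_pow]; ring
    refine ENNReal.toReal_le_of_le_ofReal (by positivity) (hle.trans ?_)
    calc _ ≤ ENNReal.ofReal (ν / c) * ENNReal.ofReal (c * ((2 * ρ) ^ N * T)) :=
          mul_le_mul' (ENNReal.ofReal_le_ofReal (min_le_right _ _)) hvol
      _ = _ := by
          rw [← ENNReal.ofReal_mul (by positivity)]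
          congr 1
          field_simp
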